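/- Converse part of the main theorem: For every bipartite quantum state ρ^{AB} on finite-dimensional systems and every R ≥ 0, if the rate pair (P,R) is achievable by local purity distillation protocols, then P ≤ κ*_→(ρ^{AB}, R) = κ(ρ^A) + κ(ρ^B) + P_→(ρ^{AB}, R). -/

import Mathlib

noncomputable section
namespace LPD

open Matrix Kronecker BigOperators Filter Finset
open scoped ComplexOrder

/-- The positive semidefinite square root of a positive semidefinite matrix
(Mathlib's former `Matrix.PosSemidef.sqrt`, with its old definition). -/
def _root_.Matrix.PosSemidef.sqrt {n 𝕜 : Type*} [Fintype n] [RCLike 𝕜] [DecidableEq n]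
    {A : Matrix n n 𝕜} (hA : PosSemidef A) : Matrix n n 𝕜 :=
  hA.1.eigenvectorUnitary.1 * diagonal ((↑) ∘ Real.sqrt ∘ hA.1.eigenvalues) *
  (star hA.1.eigenvectorUnitary : Matrix n n 𝕜)

/-- The trace norm `‖ω‖₁ = Tr √(ωᴴ ω)` of a matrix. -/
def traceNorm {ι : Type*} [Fintype ι] [DecidableEq ι] (ω : Matrix ι ι ℂ) : ℝ :=
  ((Matrix.posSemidef_conjTranspose_mul_self ω).sqrt).trace.re

/-- A density operator: positive semidefinite with trace one. -/
def IsDensity {ι : Type*} [Fintype ι] (ρ : Matrix ι ι ℂ) : Prop :=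
  ρ.PosSemidef ∧ ρ.trace = 1

/-- The von Neumann entropy `H(ρ) = -Tr(ρ log ρ)`, expressed via eigenvalues
(with the convention `0 log 0 = 0`, and junk value `0` on non-Hermitian input). -/
def entropy {ι : Type*} [Fintype ι] [DecidableEq ι] (ρ : Matrix ι ι ℂ) : ℝ :=
  letI := Classical.dec ρ.IsHermitian
  if h : ρ.IsHermitian then -∑ i, h.eigenvalues i * Real.log (h.eigenvalues i) else 0

/-- Partial trace over the first (left) tensor factor. -/
def ptraceLeft {α β : Type*} [Fintype α] (ρ : Matrix (α × β) (α × β) ℂ) : Matrix β β ℂ :=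
  fun b b' => ∑ a, ρ (a, b) (a, b')

/-- Partial trace over the second (right) tensor factor. -/
def ptraceRight {α β : Type*} [Fintype β] (ρ : Matrix (α × β) (α × β) ℂ) : Matrix α α ℂ :=
  fun a a' => ∑ b, ρ (a, b) (a', b)

/-- Quantum mutual information `I(A;B) = H(A) + H(B) - H(AB)` of a bipartite state. -/
def mutualInfo {α β : Type*} [Fintype α] [DecidableEq α] [Fintype β] [DecidableEq β]
    (ρ : Matrix (α × β) (α × β) ℂ) : ℝ :=
  entropy (ptraceRight ρ) + entropy (ptraceLeft ρ) - entropy ρ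

/-- Conditional entropy `H(B|A) = H(AB) - H(A)` (second system conditioned on the first). -/
def condEntropySnd {α β : Type*} [Fintype α] [DecidableEq α] [Fintype β] [DecidableEq β]
    (ρ : Matrix (α × β) (α × β) ℂ) : ℝ :=
  entropy ρ - entropy (ptraceRight ρ)

/-- Conditional entropy `H(A|B) = H(AB) - H(B)` (first system conditioned on the second). -/
def condEntropyFst {α β : Type*} [Fintype α] [DecidableEq α] [Fintype β] [DecidableEq β]
    (ρ : Matrix (α × β) (α × β) ℂ) : ℝ :=
  entropy ρ - entropy (ptraceLeft ρ)

/-- `n`-fold tensor power of a matrix. -/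
def tpow {ι : Type*} (ρ : Matrix ι ι ℂ) (n : ℕ) : Matrix (Fin n → ι) (Fin n → ι) ℂ :=
  fun x y => ∏ k, ρ (x k) (y k)

/-- `n`-fold tensor power of a bipartite state, with the `A` and `B` factors collected. -/
def tpowAB {α β : Type*} (ρ : Matrix (α × β) (α × β) ℂ) (n : ℕ) :
    Matrix ((Fin n → α) × (Fin n → β)) ((Fin n → α) × (Fin n → β)) ℂ :=
  Matrix.reindex (Equiv.arrowProdEquivProdArrow (Fin n) (fun _ => α) (fun _ => β))
    (Equiv.arrowProdEquivProdArrow (Fin n) (fun _ => α) (fun _ => β)) (tpow ρ n)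

/-- A POVM on the system `ι` with outcome set `κ`. -/
structure POVM (ι κ : Type*) [Fintype ι] [DecidableEq ι] [Fintype κ] where
  elem : κ → Matrix ι ι ℂ
  pos : ∀ y, (elem y).PosSemidef
  sum_eq : ∑ y, elem y = 1

/-- Apply a POVM to the first factor of a bipartite state, recording the outcome in a
classical register: `ρ^{AΓ} ↦ Σ_y |y⟩⟨y| ⊗ Tr_A((Λ_y ⊗ 1)ρ)`. -/
def measureLeft {ι κ γ : Type*} [Fintype ι] [DecidableEq ι] [Fintype κ] [DecidableEq κ]
    (Λ : POVM ι κ) (ρ : Matrix (ι × γ) (ι × γ) ℂ) : Matrix (κ × γ) (κ × γ) ℂ :=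
  fun p q => if p.1 = q.1 then ∑ a, ∑ a', (Λ.elem p.1) a a' * ρ (a', p.2) (a, q.2) else 0

/-- The canonical purification of a density operator `ρ` on `ι`, a pure state on `ι × ι`
(junk value `0` for non-positive-semidefinite input). -/
def canonicalPurification {ι : Type*} [Fintype ι] [DecidableEq ι] (ρ : Matrix ι ι ℂ) :
    Matrix (ι × ι) (ι × ι) ℂ :=
  letI := Classical.dec ρ.PosSemidef
  if h : ρ.PosSemidef then
    vecMulVec (fun p => h.sqrt p.1 p.2) (star fun p => h.sqrt p.1 p.2)
  else 0

/-- The purity `κ(ρ) = log d - H(ρ)`. -/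
def kappa {ι : Type*} [Fintype ι] [DecidableEq ι] (ρ : Matrix ι ι ℂ) : ℝ :=
  Real.log (Fintype.card ι) - entropy ρ

/-- The pure state `|0⟩⟨0|` on a `d`-dimensional system. -/
def pureZero (d : ℕ) : Matrix (Fin d) (Fin d) ℂ :=
  fun i j => if i.val = 0 ∧ j.val = 0 then 1 else 0

/-! ### Index bookkeeping equivalences -/

/-- `(a × b) × c ≃ (a × c) × b`. -/
def swapE (a b c : Type*) : (a × b) × c ≃ (a × c) × b where
  toFun x := ((x.1.1, x.2), x.1.2)
  invFun x := ((x.1.1, x.2), x.1.2)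
  left_inv _ := rfl
  right_inv _ := rfl

/-- Pull the `Y` register to the front: `((a × y) × g) × b ≃ y × ((a × g) × b)`. -/
def pullY (a y g b : Type*) : ((a × y) × g) × b ≃ y × ((a × g) × b) where
  toFun x := (x.1.1.2, ((x.1.1.1, x.1.2), x.2))
  invFun x := (((x.2.1.1, x.1), x.2.1.2), x.2.2)
  left_inv _ := rfl
  right_inv _ := rfl

/-- Rearrange for Bob's unitary: `((a × y) × g) × b ≃ (b × y) × (a × g)`. -/
def pullBY (a y g b : Type*) : ((a × y) × g) × b ≃ (b × y) × (a × g) where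
  toFun x := ((x.2, x.1.1.2), (x.1.1.1, x.1.2))
  invFun x := (((x.2.1, x.1.2), x.2.2), x.1.1)
  left_inv _ := rfl
  right_inv _ := rfl

/-- Collect `Y` and `B` together: `((a × y) × g) × b ≃ (y × b) × (a × g)`. -/
def pullYB (a y g b : Type*) : ((a × y) × g) × b ≃ (y × b) × (a × g) where
  toFun x := ((x.1.1.2, x.2), (x.1.1.1, x.1.2))
  invFun x := (((x.2.1, x.1.1), x.2.2), x.1.2)
  left_inv _ := rfl
  right_inv _ := rfl

/-- Sort output registers: `(bp × bg) × (ap × ag) ≃ (ap × bp) × (ag × bg)`. -/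
def sortOut (bp bg ap ag : Type*) : (bp × bg) × (ap × ag) ≃ (ap × bp) × (ag × bg) where
  toFun x := ((x.2.1, x.1.1), (x.2.2, x.1.2))
  invFun x := ((x.1.2, x.2.2), (x.1.1, x.2.1))
  left_inv _ := rfl
  right_inv _ := rfl

/-- `y × (x × w) ≃ (y × w) × x`. -/
def exYW (y x w : Type*) : y × (x × w) ≃ (y × w) × x where
  toFun a := ((a.1, a.2.2), a.2.1)
  invFun a := (a.1.1, (a.2, a.1.2))
  left_inv _ := rfl
  right_inv _ := rfl

/-- `y × (x × w) ≃ (y × x) × w`. -/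
def exYX (y x w : Type*) : y × (x × w) ≃ (y × x) × w where
  toFun a := ((a.1, a.2.1), a.2.2)
  invFun a := (a.1.1, (a.1.2, a.2))
  left_inv _ := rfl
  right_inv _ := rfl

/-- `y × (x × (b × e)) ≃ (y × b) × (x × e)`. -/
def exYB (y x b e : Type*) : y × (x × (b × e)) ≃ (y × b) × (x × e) where
  toFun a := ((a.1, a.2.2.1), (a.2.1, a.2.2.2))
  invFun a := (a.1.1, (a.2.1, (a.1.2, a.2.2)))
  left_inv _ := rfl
  right_inv _ := rfl

/-! ### The state `σ^{YBE}` obtained by measuring Alice's share of a purification -/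

/-- The canonical purification of a bipartite state `ρ^{AB}`, with indices arranged as
`A × (B × E)` where `E = A × B`. -/
def purifyAssoc {α β : Type*} [Fintype α] [DecidableEq α] [Fintype β] [DecidableEq β]
    (ρ : Matrix (α × β) (α × β) ℂ) :
    Matrix (α × (β × (α × β))) (α × (β × (α × β))) ℂ :=
  Matrix.reindex (Equiv.prodAssoc α β (α × β)) (Equiv.prodAssoc α β (α × β))
    (canonicalPurification ρ)

/-- `σ^{YBE} = (Λ ⊗ 1^{BE})(Ψ^{ABE})` for the canonical purification `Ψ` of `ρ^{AB}`. -/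
def sigmaOf {α β κ : Type*} [Fintype α] [DecidableEq α] [Fintype β] [DecidableEq β]
    [Fintype κ] [DecidableEq κ] (ρ : Matrix (α × β) (α × β) ℂ) (Λ : POVM α κ) :
    Matrix (κ × (β × (α × β))) (κ × (β × (α × β))) ℂ :=
  measureLeft Λ (purifyAssoc ρ)

/-- `I(Y;B)` evaluated on a state of the form `σ^{Y(BE)}`: trace out `E`, then take the
mutual information. -/
def IYB {κ β ε : Type*} [Fintype κ] [DecidableEq κ] [Fintype β] [DecidableEq β] [Fintype ε]
    (σ : Matrix (κ × (β × ε)) (κ × (β × ε)) ℂ) : ℝ :=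
  mutualInfo (ptraceRight (Matrix.reindex (Equiv.prodAssoc κ β ε).symm
    (Equiv.prodAssoc κ β ε).symm σ))

/-- `I(Y;BE)` evaluated on a state of the form `σ^{Y(BE)}`. -/
def IYBE {κ β ε : Type*} [Fintype κ] [DecidableEq κ] [Fintype β] [DecidableEq β] [Fintype ε]
    [DecidableEq ε] (σ : Matrix (κ × (β × ε)) (κ × (β × ε)) ℂ) : ℝ :=
  mutualInfo σ

/-- `P^{(1)}_→(ρ^{AB}, R) = max_Λ { I(Y;B)_σ : I(Y;BE)_σ ≤ R }`, the maximum over all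
POVMs on Alice's system. -/
def P1 {α β : Type*} [Fintype α] [DecidableEq α] [Fintype β] [DecidableEq β]
    (ρ : Matrix (α × β) (α × β) ℂ) (R : ℝ) : ℝ :=
  sSup { v : ℝ | ∃ (m : ℕ) (Λ : POVM α (Fin m)),
    IYBE (sigmaOf ρ Λ) ≤ R ∧ v = IYB (sigmaOf ρ Λ) }

/-! ### Local purity distillation protocols -/

/-- An `(n, ·, ·, ·)` local purity distillation protocol: Alice's unitary
`U_A : H_{A^n} ⊗ H_C → H_{A_p} ⊗ H_Y ⊗ H_{A_g}`, a dephasing channel on `Y`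
(applied below), and Bob's unitary `U_B : H_{B^n} ⊗ H_Y → H_{B_p} ⊗ H_{B_g}`. -/
structure Protocol (α β : Type*) [Fintype α] [DecidableEq α] [Fintype β] [DecidableEq β]
    (n : ℕ) where
  dC : ℕ
  dAp : ℕ
  dY : ℕ
  dAg : ℕ
  dBp : ℕ
  dBg : ℕ
  dC_pos : 0 < dC
  dAp_pos : 0 < dAp
  dY_pos : 0 < dY
  dAg_pos : 0 < dAg
  dBp_pos : 0 < dBp
  dBg_pos : 0 < dBg
  UA : Matrix ((Fin dAp × Fin dY) × Fin dAg) ((Fin n → α) × Fin dC) ℂ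
  UA_unitary : UAᴴ * UA = 1 ∧ UA * UAᴴ = 1
  UB : Matrix (Fin dBp × Fin dBg) ((Fin n → β) × Fin dY) ℂ
  UB_unitary : UBᴴ * UB = 1 ∧ UB * UBᴴ = 1

variable {α β : Type*} [Fintype α] [DecidableEq α] [Fintype β] [DecidableEq β]

/-- The input state `(ρ^{AB})^{⊗n} ⊗ |0⟩⟨0|^C`, arranged as `(A^n × C) × B^n`. -/
def inputState (ρ : Matrix (α × β) (α × β) ℂ) {n : ℕ} (Pr : Protocol α β n) :
    Matrix (((Fin n → α) × Fin Pr.dC) × (Fin n → β))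
      (((Fin n → α) × Fin Pr.dC) × (Fin n → β)) ℂ :=
  Matrix.reindex (swapE (Fin n → α) (Fin n → β) (Fin Pr.dC))
    (swapE (Fin n → α) (Fin n → β) (Fin Pr.dC)) (tpowAB ρ n ⊗ₖ pureZero Pr.dC)

/-- The state `U_A((ρ^{AB})^{⊗n} ⊗ |0⟩⟨0|^C)` (before dephasing), on
`((A_p × Y) × A_g) × B^n`. -/
def stateAfterUA (ρ : Matrix (α × β) (α × β) ℂ) {n : ℕ} (Pr : Protocol α β n) :
    Matrix (((Fin Pr.dAp × Fin Pr.dY) × Fin Pr.dAg) × (Fin n → β))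
      (((Fin Pr.dAp × Fin Pr.dY) × Fin Pr.dAg) × (Fin n → β)) ℂ :=
  (Pr.UA ⊗ₖ (1 : Matrix (Fin n → β) (Fin n → β) ℂ)) * inputState ρ Pr *
    (Pr.UA ⊗ₖ (1 : Matrix (Fin n → β) (Fin n → β) ℂ))ᴴ

/-- Dephase the first tensor factor in a fixed basis. -/
def dephaseFst {κ γ : Type*} [DecidableEq κ] (ρ : Matrix (κ × γ) (κ × γ) ℂ) :
    Matrix (κ × γ) (κ × γ) ℂ :=
  fun p q => if p.1 = q.1 then ρ p q else 0

/-- The state after Alice's unitary and the dephasing channel on `Y`. -/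
def stateAfterDephasing (ρ : Matrix (α × β) (α × β) ℂ) {n : ℕ} (Pr : Protocol α β n) :
    Matrix (((Fin Pr.dAp × Fin Pr.dY) × Fin Pr.dAg) × (Fin n → β))
      (((Fin Pr.dAp × Fin Pr.dY) × Fin Pr.dAg) × (Fin n → β)) ℂ :=
  Matrix.reindex (pullY (Fin Pr.dAp) (Fin Pr.dY) (Fin Pr.dAg) (Fin n → β)).symm
    (pullY (Fin Pr.dAp) (Fin Pr.dY) (Fin Pr.dAg) (Fin n → β)).symm
    (dephaseFst (Matrix.reindex (pullY (Fin Pr.dAp) (Fin Pr.dY) (Fin Pr.dAg) (Fin n → β))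
      (pullY (Fin Pr.dAp) (Fin Pr.dY) (Fin Pr.dAg) (Fin n → β)) (stateAfterUA ρ Pr)))

/-- The final state `Υ`, after Bob's unitary, on `(B_p × B_g) × (A_p × A_g)`. -/
def stateAfterUB (ρ : Matrix (α × β) (α × β) ℂ) {n : ℕ} (Pr : Protocol α β n) :
    Matrix ((Fin Pr.dBp × Fin Pr.dBg) × (Fin Pr.dAp × Fin Pr.dAg))
      ((Fin Pr.dBp × Fin Pr.dBg) × (Fin Pr.dAp × Fin Pr.dAg)) ℂ :=
  (Pr.UB ⊗ₖ (1 : Matrix (Fin Pr.dAp × Fin Pr.dAg) (Fin Pr.dAp × Fin Pr.dAg) ℂ)) *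
    Matrix.reindex (pullBY (Fin Pr.dAp) (Fin Pr.dY) (Fin Pr.dAg) (Fin n → β))
      (pullBY (Fin Pr.dAp) (Fin Pr.dY) (Fin Pr.dAg) (Fin n → β)) (stateAfterDephasing ρ Pr) *
    (Pr.UB ⊗ₖ (1 : Matrix (Fin Pr.dAp × Fin Pr.dAg) (Fin Pr.dAp × Fin Pr.dAg) ℂ))ᴴ

/-- The reduced output state `Υ^{A_p B_p}`. -/
def outputReduced (ρ : Matrix (α × β) (α × β) ℂ) {n : ℕ} (Pr : Protocol α β n) :
    Matrix (Fin Pr.dAp × Fin Pr.dBp) (Fin Pr.dAp × Fin Pr.dBp) ℂ :=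
  ptraceRight (Matrix.reindex
    (sortOut (Fin Pr.dBp) (Fin Pr.dBg) (Fin Pr.dAp) (Fin Pr.dAg))
    (sortOut (Fin Pr.dBp) (Fin Pr.dBg) (Fin Pr.dAp) (Fin Pr.dAg)) (stateAfterUB ρ Pr))

/-- The error of a protocol: trace distance of `Υ^{A_p B_p}` from `|0⟩⟨0| ⊗ |0⟩⟨0|`. -/
def protocolError (ρ : Matrix (α × β) (α × β) ℂ) {n : ℕ} (Pr : Protocol α β n) : ℝ :=
  traceNorm (outputReduced ρ Pr - pureZero Pr.dAp ⊗ₖ pureZero Pr.dBp)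

/-- The classical communication rate `(1/n) log d_Y` of a protocol. -/
def commRate {n : ℕ} (Pr : Protocol α β n) : ℝ := Real.log Pr.dY / n

/-- The purity rate `(1/n)(log d_{A_p}d_{B_p} - log d_C)` of a protocol. -/
def purityRate {n : ℕ} (Pr : Protocol α β n) : ℝ :=
  (Real.log (Pr.dAp * Pr.dBp) - Real.log Pr.dC) / n

/-- Achievability of a rate pair `(P, R)`: for all `ε, δ > 0` and all sufficiently large `n`
there is an `(n, R+δ, P-δ, ε)` protocol. -/
def Achievable (ρ : Matrix (α × β) (α × β) ℂ) (P R : ℝ) : Prop :=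
  ∀ ε > (0 : ℝ), ∀ δ > (0 : ℝ), ∃ N : ℕ, ∀ n ≥ N, ∃ Pr : Protocol α β n,
    commRate Pr ≤ R + δ ∧ P - δ ≤ purityRate Pr ∧ protocolError ρ Pr ≤ ε

/-- The 1-way distillable local purity `κ_→(ρ^{AB}, R)`. -/
def kappaArrow (ρ : Matrix (α × β) (α × β) ℂ) (R : ℝ) : ℝ :=
  sSup { P : ℝ | Achievable ρ P R }

/-- `I(Y;B^n)` on the pre-dephasing state `U_A((ρ^{AB})^{⊗n} ⊗ |0⟩⟨0|^C)`. -/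
def preDephIYB (ρ : Matrix (α × β) (α × β) ℂ) {n : ℕ} (Pr : Protocol α β n) : ℝ :=
  mutualInfo (ptraceRight (Matrix.reindex
    (pullYB (Fin Pr.dAp) (Fin Pr.dY) (Fin Pr.dAg) (Fin n → β))
    (pullYB (Fin Pr.dAp) (Fin Pr.dY) (Fin Pr.dAg) (Fin n → β)) (stateAfterUA ρ Pr)))

/-- The pre-dephasing state together with the purifying environment `E^n`:
`(U_A ⊗ 1^{B^nE^n})((Ψ^{ABE})^{⊗n} ⊗ |0⟩⟨0|^C)`, where `Ψ` is the canonical purification. -/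
def preDephWithEnv (ρ : Matrix (α × β) (α × β) ℂ) {n : ℕ} (Pr : Protocol α β n) :
    Matrix (((Fin Pr.dAp × Fin Pr.dY) × Fin Pr.dAg) × (Fin n → β × (α × β)))
      (((Fin Pr.dAp × Fin Pr.dY) × Fin Pr.dAg) × (Fin n → β × (α × β))) ℂ :=
  (Pr.UA ⊗ₖ (1 : Matrix (Fin n → β × (α × β)) (Fin n → β × (α × β)) ℂ)) *
    Matrix.reindex (swapE (Fin n → α) (Fin n → β × (α × β)) (Fin Pr.dC))
      (swapE (Fin n → α) (Fin n → β × (α × β)) (Fin Pr.dC))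
      (tpowAB (purifyAssoc ρ) n ⊗ₖ pureZero Pr.dC) *
    (Pr.UA ⊗ₖ (1 : Matrix (Fin n → β × (α × β)) (Fin n → β × (α × β)) ℂ))ᴴ

/-- `I(Y;B^nE^n)` on the pre-dephasing state, including the purifying environment. -/
def preDephIYBE (ρ : Matrix (α × β) (α × β) ℂ) {n : ℕ} (Pr : Protocol α β n) : ℝ :=
  mutualInfo (ptraceRight (Matrix.reindex
    (pullYB (Fin Pr.dAp) (Fin Pr.dY) (Fin Pr.dAg) (Fin n → β × (α × β)))
    (pullYB (Fin Pr.dAp) (Fin Pr.dY) (Fin Pr.dAg) (Fin n → β × (α × β)))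
    (preDephWithEnv ρ Pr)))

/-- `H(Y)` on the pre-dephasing state. -/
def preDephHY (ρ : Matrix (α × β) (α × β) ℂ) {n : ℕ} (Pr : Protocol α β n) : ℝ :=
  entropy (ptraceRight (Matrix.reindex
    (pullY (Fin Pr.dAp) (Fin Pr.dY) (Fin Pr.dAg) (Fin n → β))
    (pullY (Fin Pr.dAp) (Fin Pr.dY) (Fin Pr.dAg) (Fin n → β)) (stateAfterUA ρ Pr)))

/-! ### Single-party purity concentration -/

/-- An `(n, ·, ·)` purity concentration protocol: a unitary
`U : H_{A^n} → H_{A_p} ⊗ H_{A_g}`. -/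
structure ConcProtocol (α : Type*) [Fintype α] [DecidableEq α] (n : ℕ) where
  dAp : ℕ
  dAg : ℕ
  dAp_pos : 0 < dAp
  dAg_pos : 0 < dAg
  U : Matrix (Fin dAp × Fin dAg) (Fin n → α) ℂ
  U_unitary : Uᴴ * U = 1 ∧ U * Uᴴ = 1

/-- The reduced state `Υ^{A_p}` of `U ρ^{⊗n} U†`. -/
def concOutput {α : Type*} [Fintype α] [DecidableEq α] (ρ : Matrix α α ℂ) {n : ℕ}
    (Pr : ConcProtocol α n) : Matrix (Fin Pr.dAp) (Fin Pr.dAp) ℂ :=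
  ptraceRight (Pr.U * tpow ρ n * Pr.Uᴴ)

/-- Achievability of a purity-concentration rate `P`. -/
def ConcAchievable {α : Type*} [Fintype α] [DecidableEq α] (ρ : Matrix α α ℂ) (P : ℝ) :
    Prop :=
  ∀ ε > (0 : ℝ), ∀ δ > (0 : ℝ), ∃ N : ℕ, ∀ n ≥ N, ∃ Pr : ConcProtocol α n,
    P - δ ≤ Real.log Pr.dAp / n ∧ traceNorm (concOutput ρ Pr - pureZero Pr.dAp) ≤ ε

/-- The purity `κ(ρ)`: the supremum of all achievable concentration rates. -/
def kappaConc {α : Type*} [Fintype α] [DecidableEq α] (ρ : Matrix α α ℂ) : ℝ :=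
  sSup { P : ℝ | ConcAchievable ρ P }

/-! ### Measurement compression -/

/-- The averaged compressed-measurement map
`σ ↦ (1/|L|) Σ_l Σ_m Tr(Λ̃^{(l)}_m σ) |f(m,l)⟩⟨f(m,l)|`, applied to the first factor. -/
def mcMap {A Ω γ' : Type*} [Fintype A] [DecidableEq A] [Fintype Ω] [DecidableEq Ω]
    (L M : ℕ) (Λt : Fin L → POVM A (Fin M)) (f : Fin M → Fin L → Ω)
    (ρ : Matrix (A × γ') (A × γ') ℂ) : Matrix (Ω × γ') (Ω × γ') ℂ :=
  fun p q => (L : ℂ)⁻¹ * ∑ l, ∑ m, (if f m l = p.1 ∧ f m l = q.1 then 1 else 0) *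
    ∑ a, ∑ a', ((Λt l).elem m) a a' * ρ (a', p.2) (a, q.2)

/-! ### Classical-quantum states and classical channels -/

/-- The classical-quantum state `Σ_x p(x) |x⟩⟨x| ⊗ ρ_x`. -/
def cqState {𝒳 B : Type*} [DecidableEq 𝒳] (p : 𝒳 → ℝ) (ρx : 𝒳 → Matrix B B ℂ) :
    Matrix (𝒳 × B) (𝒳 × B) ℂ :=
  fun P Q => if P.1 = Q.1 then (p P.1 : ℂ) * ρx P.1 P.2 Q.2 else 0

/-- The state on `Y × (X × W)` obtained from a purification vector `ψ` of a cq state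
(with classical system `X` and the rest `W`) by applying a classical channel `q(y|x)`
to the classical system: `Σ_{x,y} q(y|x) |y⟩⟨y| ⊗ |x⟩⟨x|-block of p(x)·(BE state given x)`. -/
def chanState {𝒳 W 𝒴 : Type*} [DecidableEq 𝒳] [DecidableEq 𝒴]
    (ψ : 𝒳 × W → ℂ) (q : 𝒳 → 𝒴 → ℝ) :
    Matrix (𝒴 × (𝒳 × W)) (𝒴 × (𝒳 × W)) ℂ :=
  fun P Q => if P.1 = Q.1 ∧ P.2.1 = Q.2.1
    then (q P.2.1 P.1 : ℂ) * ψ P.2 * star (ψ Q.2) else 0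

/-- The `n`-fold tensor power of a purification vector of a cq state, with the
classical, `B` and `E` registers collected. -/
def vecPowBE {𝒳 B E : Type*} (ψ : 𝒳 × (B × E) → ℂ) (n : ℕ) :
    (Fin n → 𝒳) × ((Fin n → B) × (Fin n → E)) → ℂ :=
  fun xw => ∏ k, ψ (xw.1 k, (xw.2.1 k, xw.2.2 k))

variable {𝒴' 𝒳 B E : Type*} [Fintype 𝒴'] [DecidableEq 𝒴'] [Fintype 𝒳] [DecidableEq 𝒳]
  [Fintype B] [DecidableEq B] [Fintype E] [DecidableEq E]

/-- `I(Y;B)` on a state of the form `τ^{Y(X(BE))}`. -/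
def miYB (τ : Matrix (𝒴' × (𝒳 × (B × E))) (𝒴' × (𝒳 × (B × E))) ℂ) : ℝ :=
  mutualInfo (ptraceRight (Matrix.reindex (exYB 𝒴' 𝒳 B E) (exYB 𝒴' 𝒳 B E) τ))

/-- `I(Y;BE)` on a state of the form `τ^{Y(X(BE))}`. -/
def miYBE (τ : Matrix (𝒴' × (𝒳 × (B × E))) (𝒴' × (𝒳 × (B × E))) ℂ) : ℝ :=
  mutualInfo (ptraceRight (Matrix.reindex (exYW 𝒴' 𝒳 (B × E)) (exYW 𝒴' 𝒳 (B × E)) τ))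

/-- `I(Y;X)` on a state of the form `τ^{Y(X(BE))}`. -/
def miYX (τ : Matrix (𝒴' × (𝒳 × (B × E))) (𝒴' × (𝒳 × (B × E))) ℂ) : ℝ :=
  mutualInfo (ptraceRight (Matrix.reindex (exYX 𝒴' 𝒳 (B × E)) (exYX 𝒴' 𝒳 (B × E)) τ))

/-- A classical channel: entrywise nonnegative with rows summing to one. -/
def IsChannel {X Y : Type*} [Fintype Y] (q : X → Y → ℝ) : Prop :=
  (∀ x y, 0 ≤ q x y) ∧ ∀ x, ∑ y, q x y = 1

/-- `P_n(R) = max_{Y|X^n} { (1/n) I(Y;B^n) : (1/n) I(Y;B^nE^n) ≤ R }` for a cq state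
with purification vector `ψ`. -/
def Pn (ψ : 𝒳 × (B × E) → ℂ) (n : ℕ) (R : ℝ) : ℝ :=
  sSup { v : ℝ | ∃ (m : ℕ) (q : (Fin n → 𝒳) → Fin m → ℝ), IsChannel q ∧
    (1 / n : ℝ) * miYBE (chanState (vecPowBE ψ n) q) ≤ R ∧
    v = (1 / n : ℝ) * miYB (chanState (vecPowBE ψ n) q) }

/-- `D_n(R) = max_{Y|X^n} { (1/n) I(Y;B^n) : (1/n)(I(Y;X^n) - I(Y;B^n)) ≤ R }` for a cq
state with purification vector `ψ`. -/
def Dn (ψ : 𝒳 × (B × E) → ℂ) (n : ℕ) (R : ℝ) : ℝ :=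
  sSup { v : ℝ | ∃ (m : ℕ) (q : (Fin n → 𝒳) → Fin m → ℝ), IsChannel q ∧
    (1 / n : ℝ) * (miYX (chanState (vecPowBE ψ n) q)
      - miYB (chanState (vecPowBE ψ n) q)) ≤ R ∧
    v = (1 / n : ℝ) * miYB (chanState (vecPowBE ψ n) q) }

/-! ### Quantum channels -/

/-- A completely positive trace-preserving map between matrix algebras. -/
structure CPTP (ι κ : Type*) [Fintype ι] [DecidableEq ι] [Fintype κ] [DecidableEq κ] where
  map : Matrix ι ι ℂ →ₗ[ℂ] Matrix κ κ ℂ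
  trace_preserving : ∀ ρ, (map ρ).trace = ρ.trace
  completely_positive : ∀ (n : ℕ) (ρ : Matrix (ι × Fin n) (ι × Fin n) ℂ), ρ.PosSemidef →
    (Matrix.of fun p q : κ × Fin n =>
      map (Matrix.of fun i i' => ρ (i, p.2) (i', q.2)) p.1 q.1).PosSemidef

/-- Entropy functional through the roots of the characteristic polynomial. -/
def SS {ι : Type*} [Fintype ι] [DecidableEq ι] (M : Matrix ι ι ℂ) : ℝ :=
  (M.charpoly.roots.map (fun z => Real.negMulLog z.re)).sum

set_option linter.unusedSectionVars false
set_option linter.unusedSimpArgs false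

section entropyfun
variable {ι κ γ : Type*} [Fintype ι] [DecidableEq ι] [Fintype κ] [DecidableEq κ]
  [Fintype γ] [DecidableEq γ]

lemma SS_hermitian {M : Matrix ι ι ℂ} (h : M.IsHermitian) :
    SS M = ∑ i, Real.negMulLog (h.eigenvalues i) := by
  unfold SS
  rw [h.roots_charpoly_eq_eigenvalues]
  simp

lemma entropy_eq_SS {M : Matrix ι ι ℂ} (h : M.IsHermitian) : entropy M = SS M := by
  rw [SS_hermitian h, entropy, dif_pos h, ← Finset.sum_neg_distrib]
  refine Finset.sum_congr rfl fun i _ => ?_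
  simp [Real.negMulLog]

lemma SS_diagonal (d : ι → ℂ) : SS (diagonal d) = ∑ i, Real.negMulLog (d i).re := by
  unfold SS
  rw [charpoly_diagonal, Polynomial.roots_prod]
  · simp
  · simp [Finset.prod_ne_zero_iff, Polynomial.X_sub_C_ne_zero]

lemma SS_mul_comm (A : Matrix ι κ ℂ) (B : Matrix κ ι ℂ) : SS (A * B) = SS (B * A) := by
  have h := Matrix.charpoly_mul_comm' A B
  have h1 := congrArg Polynomial.roots h
  have hne : ∀ (n : ℕ) (p : Polynomial ℂ), p.Monic → (Polynomial.X ^ n * p) ≠ 0 := by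
    intro n p hp
    exact ((Polynomial.monic_X_pow n).mul hp).ne_zero
  rw [Polynomial.roots_mul (hne _ _ (charpoly_monic _)),
    Polynomial.roots_mul (hne _ _ (charpoly_monic _))] at h1
  have h2 := congrArg (fun s : Multiset ℂ => (s.map (fun z => Real.negMulLog z.re)).sum) h1
  have hz : ∀ n : ℕ, (n • ({0} : Multiset ℝ)).sum = 0 := fun n => by
    rw [Multiset.sum_nsmul]; simp
  simpa [SS, Multiset.map_nsmul, hz] using h2

lemma SS_conj (U : Matrix κ ι ℂ) (hU : Uᴴ * U = 1) (M : Matrix ι ι ℂ) :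
    SS (U * M * Uᴴ) = SS M := by
  rw [SS_mul_comm, ← Matrix.mul_assoc, hU, Matrix.one_mul]

lemma SS_reindex (e : ι ≃ κ) (M : Matrix ι ι ℂ) : SS (Matrix.reindex e e M) = SS M := by
  unfold SS
  rw [charpoly_reindex]

lemma exists_diag {M : Matrix ι ι ℂ} (h : M.PosSemidef) :
    ∃ (U : Matrix ι ι ℂ) (d : ι → ℝ), Uᴴ * U = 1 ∧ U * Uᴴ = 1 ∧ (∀ i, 0 ≤ d i) ∧
      M = U * diagonal (fun i => (d i : ℂ)) * Uᴴ ∧ SS M = ∑ i, Real.negMulLog (d i) ∧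
      M.trace = ((∑ i, d i : ℝ) : ℂ) := by
  refine ⟨h.1.eigenvectorUnitary.1, h.1.eigenvalues, ?_, ?_, h.eigenvalues_nonneg, ?_,
    SS_hermitian h.1, ?_⟩
  · exact Unitary.coe_star_mul_self h.1.eigenvectorUnitary
  · exact Unitary.coe_mul_star_self h.1.eigenvectorUnitary
  · have := h.1.spectral_theorem
    rw [Unitary.conjStarAlgAut_apply] at this
    exact this
  · rw [h.1.trace_eq_sum_eigenvalues]; simp

/-- Peierls-type inequality. -/
lemma SS_le_diag {M : Matrix ι ι ℂ} (h : M.PosSemidef) :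
    SS M ≤ ∑ i, Real.negMulLog (M i i).re := by
  obtain ⟨U, d, hU, hU', hd, hM, hS, -⟩ := exists_diag h
  rw [hS]
  have hent : ∀ i, (M i i).re = ∑ j, Complex.normSq (U i j) * d j := by
    intro i
    rw [hM, Matrix.mul_apply, Complex.re_sum]
    refine Finset.sum_congr rfl fun j _ => ?_
    rw [Matrix.mul_diagonal, Matrix.conjTranspose_apply, mul_right_comm,
      Complex.star_def, Complex.mul_conj]
    simp [← Complex.ofReal_mul]
  have hrow : ∀ i, ∑ j, Complex.normSq (U i j) = 1 := by
    intro i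
    have := congrFun (congrFun hU' i) i
    rw [Matrix.mul_apply] at this
    simp only [Matrix.conjTranspose_apply, Complex.star_def, Complex.mul_conj,
      Matrix.one_apply_eq] at this
    exact_mod_cast this
  have hcol : ∀ j, ∑ i, Complex.normSq (U i j) = 1 := by
    intro j
    have := congrFun (congrFun hU j) j
    rw [Matrix.mul_apply] at this
    simp only [Matrix.conjTranspose_apply, Complex.star_def, mul_comm ((starRingEnd ℂ) _),
      Complex.mul_conj, Matrix.one_apply_eq] at this
    exact_mod_cast this
  calc ∑ j, Real.negMulLog (d j)
      = ∑ j, ∑ i, Complex.normSq (U i j) * Real.negMulLog (d j) := by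
        refine Finset.sum_congr rfl fun j _ => ?_
        rw [← Finset.sum_mul, hcol, one_mul]
    _ = ∑ i, ∑ j, Complex.normSq (U i j) * Real.negMulLog (d j) := Finset.sum_comm
    _ ≤ ∑ i, Real.negMulLog (M i i).re := by
        refine Finset.sum_le_sum fun i _ => ?_
        rw [hent]
        have := Real.concaveOn_negMulLog.le_map_sum (t := Finset.univ)
          (w := fun j => Complex.normSq (U i j)) (p := d)
          (fun j _ => Complex.normSq_nonneg _) (hrow i) (fun j _ => hd j)
        simpa using this

/-- Subadditivity under sums of positive semidefinite matrices. -/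
lemma SS_sum_le (M : κ → Matrix ι ι ℂ) (h : ∀ y, (M y).PosSemidef) :
    SS (∑ y, M y) ≤ ∑ y, SS (M y) := by
  choose U d hU hU' hd hM hS ht using fun y => exists_diag (h y)
  let K : Matrix ι (κ × ι) ℂ := fun i p => U p.1 i p.2 * (Real.sqrt (d p.1 p.2) : ℂ)
  have hK : ∑ y, M y = K * Kᴴ := by
    ext i j
    rw [Matrix.sum_apply, Matrix.mul_apply, Fintype.sum_prod_type]
    refine Finset.sum_congr rfl fun y _ => ?_
    rw [hM y, Matrix.mul_apply]
    refine Finset.sum_congr rfl fun k _ => ?_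
    rw [Matrix.mul_diagonal]
    rw [Matrix.conjTranspose_apply, Matrix.conjTranspose_apply]
    simp only [K, star_mul', Complex.star_def, Complex.conj_ofReal]
    have : (d y k : ℂ) = (Real.sqrt (d y k) : ℂ) * (Real.sqrt (d y k) : ℂ) := by
      rw [← Complex.ofReal_mul, Real.mul_self_sqrt (hd y k)]
    rw [this]; ring
  have hdiag : ∀ p, ((Kᴴ * K) p p).re = d p.1 p.2 := by
    intro p
    rw [Matrix.mul_apply]
    have h1 := congrFun (congrFun (hU p.1) p.2) p.2
    rw [Matrix.mul_apply, Matrix.one_apply_eq] at h1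
    have : ∑ j, Kᴴ p j * K j p = (d p.1 p.2 : ℂ) := by
      have h2 : (d p.1 p.2 : ℂ) = (Real.sqrt (d p.1 p.2) : ℂ) * (Real.sqrt (d p.1 p.2) : ℂ) := by
        rw [← Complex.ofReal_mul, Real.mul_self_sqrt (hd _ _)]
      rw [h2, ← mul_one ((Real.sqrt (d p.1 p.2) : ℂ) * _), ← h1, Finset.mul_sum]
      refine Finset.sum_congr rfl fun k _ => ?_
      rw [Matrix.conjTranspose_apply, Matrix.conjTranspose_apply]
      simp only [K, star_mul', Complex.star_def, Complex.conj_ofReal]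
      ring
    rw [this, Complex.ofReal_re]
  rw [hK, SS_mul_comm]
  refine (SS_le_diag (posSemidef_conjTranspose_mul_self K)).trans ?_
  simp only [hdiag, Fintype.sum_prod_type, hS, le_refl]

lemma SS_add_le {M N : Matrix ι ι ℂ} (hM : M.PosSemidef) (hN : N.PosSemidef) :
    SS (M + N) ≤ SS M + SS N := by
  have := SS_sum_le (fun b : Bool => cond b M N) (by rintro (_ | _) <;> simpa)
  simpa using this

lemma negMulLog_tangent {x c : ℝ} (hx : 0 ≤ x) (hc : 0 < c) :
    Real.negMulLog x ≤ - x * Real.log c + c - x := by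
  rcases hx.eq_or_lt with rfl | hx
  · simp [hc.le]
  · have h := Real.log_le_sub_one_of_pos (div_pos hc hx)
    rw [Real.log_div hc.ne' hx.ne'] at h
    have := mul_le_mul_of_nonneg_left h hx.le
    have h2 : x * (c / x - 1) = c - x := by field_simp
    rw [h2] at this
    unfold Real.negMulLog
    nlinarith

lemma SS_nonneg {M : Matrix ι ι ℂ} (h : M.PosSemidef) (ht : M.trace.re ≤ 1) : 0 ≤ SS M := by
  obtain ⟨U, d, hU, hU', hd, hM, hS, hT⟩ := exists_diag h
  rw [hS]
  refine Finset.sum_nonneg fun i _ => Real.negMulLog_nonneg (hd i) ?_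
  rw [hT, Complex.ofReal_re] at ht
  exact (Finset.single_le_sum (fun i _ => hd i) (Finset.mem_univ i)).trans ht

lemma SS_le_card {M : Matrix ι ι ℂ} (h : M.PosSemidef) :
    SS M ≤ Real.negMulLog M.trace.re + M.trace.re * Real.log (Fintype.card ι) := by
  obtain ⟨U, d, hU, hU', hd, hM, hS, hT⟩ := exists_diag h
  rw [hS, hT, Complex.ofReal_re]
  rcases (Finset.sum_nonneg (fun i (_ : i ∈ Finset.univ) => hd i)).eq_or_lt with h0 | hpos
  · rw [← h0]
    have := (Finset.sum_eq_zero_iff_of_nonneg (fun i _ => hd i)).1 h0.symm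
    rw [Finset.sum_eq_zero (fun i hi => by
      show Real.negMulLog (d i) = 0
      rw [this i hi, Real.negMulLog_zero])]
    simp
  · have hN : 0 < (Fintype.card ι : ℝ) := by
      have : Nonempty ι := by
        by_contra hne
        rw [not_nonempty_iff] at hne
        simp at hpos
      exact_mod_cast Fintype.card_pos
    set t := ∑ i, d i
    have hc : 0 < t / Fintype.card ι := div_pos hpos hN
    refine (Finset.sum_le_sum fun i _ => negMulLog_tangent (hd i) hc).trans ?_
    rw [Finset.sum_sub_distrib, Finset.sum_add_distrib, ← Finset.sum_mul, Finset.sum_neg_distrib]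
    rw [Finset.sum_const, Finset.card_univ, nsmul_eq_mul, mul_div_cancel₀ _ hN.ne',
      Real.log_div hpos.ne' hN.ne']
    unfold Real.negMulLog
    apply le_of_eq
    ring

lemma SS_smul {M : Matrix ι ι ℂ} (h : M.PosSemidef) (c : ℝ) :
    SS ((c : ℂ) • M) = c * SS M + Real.negMulLog c * M.trace.re := by
  obtain ⟨U, d, hU, hU', hd, hM, hS, hT⟩ := exists_diag h
  have : (c : ℂ) • M = U * diagonal (fun i => ((c * d i : ℝ) : ℂ)) * Uᴴ := by
    rw [hM, ← Matrix.smul_mul, ← Matrix.mul_smul, ← diagonal_smul]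
    congr 3
    ext i; simp
  rw [this, SS_conj U hU, SS_diagonal, hS, hT, Complex.ofReal_re, Finset.mul_sum, Finset.mul_sum,
    ← Finset.sum_add_distrib]
  refine Finset.sum_congr rfl fun i _ => ?_
  rw [Complex.ofReal_re, Real.negMulLog_mul]; ring

/-- block diagonal with block label first -/
def cq (M : κ → Matrix ι γ ℂ) : Matrix (κ × ι) (κ × γ) ℂ :=
  fun p q => if p.1 = q.1 then M p.1 p.2 q.2 else 0

lemma cq_mul {δ : Type*} (M : κ → Matrix ι γ ℂ) (N : κ → Matrix γ δ ℂ) :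
    cq M * cq N = cq (fun y => M y * N y) := by
  ext p q
  rw [Matrix.mul_apply, Fintype.sum_prod_type]
  simp only [cq, Matrix.mul_apply, ite_mul, zero_mul, mul_ite, mul_zero]
  rw [Finset.sum_eq_single p.1 (fun b _ hb => by simp [hb.symm]) (by simp)]
  by_cases hpq : p.1 = q.1 <;> simp [hpq]

lemma cq_conjTranspose (M : κ → Matrix ι γ ℂ) : (cq M)ᴴ = cq (fun y => (M y)ᴴ) := by
  ext p q
  simp only [cq, Matrix.conjTranspose_apply]
  by_cases h : p.1 = q.1
  · simp [h]
  · have : ¬ q.1 = p.1 := fun h' => h h'.symm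
    simp [h, this]

lemma cq_diagonal (d : κ → ι → ℂ) :
    cq (fun y => diagonal (d y)) = diagonal (fun p : κ × ι => d p.1 p.2) := by
  ext p q
  simp only [cq, diagonal_apply, Prod.ext_iff]
  by_cases h : p.1 = q.1 <;> by_cases h' : p.2 = q.2 <;> simp [h, h']

lemma cq_one : cq (fun _ : κ => (1 : Matrix ι ι ℂ)) = 1 := by
  have := cq_diagonal (fun (_ : κ) (_ : ι) => (1 : ℂ))
  simpa using this

lemma SS_cq (M : κ → Matrix ι ι ℂ) (h : ∀ y, (M y).PosSemidef) :
    SS (cq M) = ∑ y, SS (M y) := by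
  choose U d hU hU' hd hM hS ht using fun y => exists_diag (h y)
  have : cq M = cq U * cq (fun y => diagonal (fun i => (d y i : ℂ))) * (cq U)ᴴ := by
    rw [cq_conjTranspose, cq_mul, cq_mul]
    congr 1
    ext1 y
    exact hM y
  rw [this, SS_conj _ (by rw [cq_conjTranspose, cq_mul]; simp only [hU]; exact cq_one),
    cq_diagonal, SS_diagonal, Fintype.sum_prod_type]
  simp [hS]

lemma cq_hermitian (M : κ → Matrix ι ι ℂ) (h : ∀ y, (M y).IsHermitian) :
    (cq M).IsHermitian := by
  rw [Matrix.IsHermitian, cq_conjTranspose]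
  congr 1
  ext1 y
  exact h y

/-- The Holevo-type quantity of an ensemble of unnormalised states. -/
def holevo (M : κ → Matrix ι ι ℂ) : ℝ :=
  ∑ y, Real.negMulLog (M y).trace.re + SS (∑ y, M y) - ∑ y, SS (M y)

lemma mutualInfo_cq (M : κ → Matrix ι ι ℂ) (h : ∀ y, (M y).PosSemidef) :
    mutualInfo (cq M) = holevo M := by
  have h1 : ptraceRight (cq M) = diagonal (fun y => (M y).trace) := by
    ext y y'
    simp only [ptraceRight, cq, diagonal_apply, Matrix.trace, Matrix.diag]
    by_cases hy : y = y' <;> simp [hy]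
  have h2 : ptraceLeft (cq M) = ∑ y, M y := by
    ext i j
    simp [ptraceLeft, cq, Matrix.sum_apply]
  have htr : ∀ y, IsSelfAdjoint (M y).trace := by
    intro y
    have := (h y).1
    rw [IsSelfAdjoint, ← Matrix.trace_conjTranspose, this]
  rw [mutualInfo, h1, h2, entropy_eq_SS (cq_hermitian M (fun y => (h y).1)),
    entropy_eq_SS (posSemidef_sum _ (fun y _ => h y)).1, entropy_eq_SS, SS_cq M h, SS_diagonal]
  · rfl
  · exact isHermitian_diagonal_of_self_adjoint _ (by ext y; exact htr y)

lemma psd_trace_re {M : Matrix ι ι ℂ} (h : M.PosSemidef) : 0 ≤ M.trace.re :=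
  (Complex.le_def.1 h.trace_nonneg).1

lemma holevo_le_log (M : κ → Matrix ι ι ℂ) (h : ∀ y, (M y).PosSemidef)
    (ht : (∑ y, M y).trace = 1) : holevo M ≤ Real.log (Fintype.card κ) := by
  have h1 := SS_sum_le M h
  have h2 : ∑ y, Real.negMulLog (M y).trace.re ≤ Real.log (Fintype.card κ) := by
    have hd : (diagonal (fun y => (((M y).trace.re : ℝ) : ℂ))).PosSemidef := by
      refine PosSemidef.diagonal ?_
      intro y
      show (0 : ℂ) ≤ (((M y).trace.re : ℝ) : ℂ)
      exact_mod_cast psd_trace_re (h y)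
    have := SS_le_card hd
    rw [SS_diagonal, Matrix.trace_diagonal] at this
    have hs : (∑ y, (((M y).trace.re : ℝ) : ℂ)).re = 1 := by
      rw [Matrix.trace_sum] at ht
      have := congrArg Complex.re ht
      simpa using this
    rw [hs] at this
    simpa using this
  unfold holevo
  linarith

lemma holevo_le_log_dim (M : κ → Matrix ι ι ℂ) (h : ∀ y, (M y).PosSemidef)
    (ht : (∑ y, M y).trace = 1) : holevo M ≤ Real.log (Fintype.card ι) := by
  have h1 := SS_le_card (posSemidef_sum (Finset.univ) (fun y _ => h y))
  rw [ht] at h1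
  have h2 : ∀ y, Real.negMulLog (M y).trace.re ≤ SS (M y) := by
    intro y
    obtain ⟨U, d, hU, hU', hd, hM, hS, hT⟩ := exists_diag (h y)
    rw [hS, hT, Complex.ofReal_re]
    unfold Real.negMulLog
    rw [← Finset.sum_neg_distrib, Finset.sum_mul]
    refine Finset.sum_le_sum fun i _ => ?_
    rcases (hd i).eq_or_lt with h0 | h0
    · simp [← h0]
    · have := Real.log_le_log h0 (Finset.single_le_sum (fun i _ => hd i) (Finset.mem_univ i))
      nlinarith
  have h3 := Finset.sum_le_sum (fun y (_ : y ∈ Finset.univ) => h2 y)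
  simp at h1
  unfold holevo
  linarith

end entropyfun

set_option linter.unusedSectionVars false
set_option linter.unusedSimpArgs false

section keylemmas
variable {ι κ γ : Type*} [Fintype ι] [DecidableEq ι] [Fintype κ] [DecidableEq κ]
  [Fintype γ] [DecidableEq γ]

lemma diag_le_traceNorm (ω : Matrix ι ι ℂ) (i : ι) : -(ω i i).re ≤ traceNorm ω := by
  set h := Matrix.posSemidef_conjTranspose_mul_self ω
  have hT : traceNorm ω = ∑ k, Real.sqrt (h.1.eigenvalues k) := by
    unfold traceNorm PosSemidef.sqrt
    have hU : (star h.1.eigenvectorUnitary : Matrix ι ι ℂ) * h.1.eigenvectorUnitary.1 = 1 :=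
      Unitary.coe_star_mul_self h.1.eigenvectorUnitary
    rw [Matrix.trace_mul_comm, ← Matrix.mul_assoc, hU, Matrix.one_mul, Matrix.trace_diagonal]
    simp
  have h1 : (ω i i).re ^ 2 ≤ (ωᴴ * ω).trace.re := by
    rw [Matrix.trace, Complex.re_sum]
    refine le_trans ?_ (Finset.single_le_sum (fun k _ => ?_) (Finset.mem_univ i))
    · rw [Matrix.diag, Matrix.mul_apply, Complex.re_sum]
      have : ∀ j, (ωᴴ i j * ω j i).re = Complex.normSq (ω j i) := by
        intro j
        rw [Matrix.conjTranspose_apply, Complex.star_def, mul_comm, Complex.mul_conj,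
          Complex.ofReal_re]
      simp only [this]
      refine le_trans ?_ (Finset.single_le_sum (fun j _ => Complex.normSq_nonneg (ω j i))
        (Finset.mem_univ i))
      rw [Complex.normSq_apply]; nlinarith [sq_nonneg (ω i i).im]
    · exact (Complex.le_def.1 (h.diag_nonneg (i := k))).1
  have h2 : (ωᴴ * ω).trace.re = ∑ k, Real.sqrt (h.1.eigenvalues k) ^ 2 := by
    rw [h.1.trace_eq_sum_eigenvalues]
    simp [Real.sq_sqrt (h.eigenvalues_nonneg _)]
  have h3 : ∑ k, Real.sqrt (h.1.eigenvalues k) ^ 2 ≤ (∑ k, Real.sqrt (h.1.eigenvalues k)) ^ 2 :=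
    Finset.sum_sq_le_sq_sum_of_nonneg (fun k _ => Real.sqrt_nonneg _)
  have h0 : 0 ≤ ∑ k, Real.sqrt (h.1.eigenvalues k) := Finset.sum_nonneg fun k _ => Real.sqrt_nonneg _
  rw [hT]
  refine (neg_le_abs _).trans ?_
  exact abs_le_of_sq_le_sq (by linarith) h0

lemma negMulLog_split {a b : ℝ} (ha : 0 ≤ a) (hb : 0 ≤ b) (hb1 : b ≤ 1) :
    Real.negMulLog a ≤ Real.negMulLog (a + b) + (a + b) * Real.log 2 := by
  rcases (add_nonneg ha hb).eq_or_lt with h0 | hpos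
  · have ha0 : a = 0 := by linarith
    have hb0 : b = 0 := by linarith
    rw [ha0, hb0]
    simp
  · have hc : 0 < (a + b) / 2 := by positivity
    have h1 := negMulLog_tangent ha hc
    have h2 := negMulLog_tangent hb hc
    have h3 := Real.negMulLog_nonneg hb hb1
    rw [Real.log_div hpos.ne' two_ne_zero] at h1 h2
    unfold Real.negMulLog at *
    nlinarith

lemma exists_factor {M : Matrix ι ι ℂ} (h : M.PosSemidef) : ∃ K : Matrix ι ι ℂ, M = K * Kᴴ := by
  obtain ⟨U, d, hU, hU', hd, hM, -, -⟩ := exists_diag h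
  refine ⟨U * diagonal (fun i => (Real.sqrt (d i) : ℂ)), ?_⟩
  rw [Matrix.conjTranspose_mul, diagonal_conjTranspose, Matrix.mul_assoc,
    ← Matrix.mul_assoc (diagonal _) (diagonal _), diagonal_mul_diagonal, ← Matrix.mul_assoc, hM]
  congr 3
  ext i
  simp [← Complex.ofReal_mul, Real.mul_self_sqrt (hd i)]

lemma log_card_nonneg (n : ℕ) : 0 ≤ Real.log n := Real.log_natCast_nonneg n

lemma key_bound {a : Type*} [Fintype a] [DecidableEq a] {ρ : Matrix ι ι ℂ} (hρ : ρ.PosSemidef)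
    (ht : ρ.trace = 1)
    (E : a → κ → Matrix γ ι ℂ) (hE : ∑ x, ∑ y, (E x y)ᴴ * E x y = 1) (x0 : a) (ε : ℝ)
    (hp : 1 - ε ≤ ∑ y, (E x0 y * ρ * (E x0 y)ᴴ).trace.re) :
    SS ρ ≤ ∑ y, Real.negMulLog (∑ x, (E x y * ρ * (E x y)ᴴ).trace.re) + (Real.log 2 + 1)
      + Real.log (Fintype.card γ) + ε * Real.log (Fintype.card ι) := by
  obtain ⟨K, hK⟩ := exists_factor hρ
  have hq0 : ∀ x y, 0 ≤ (E x y * ρ * (E x y)ᴴ).trace.re := fun x y =>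
    psd_trace_re (hρ.mul_mul_conjTranspose_same _)
  have htr : ∀ x y, (E x y * ρ * (E x y)ᴴ).trace = (Kᴴ * ((E x y)ᴴ * E x y) * K).trace := by
    intro x y
    rw [hK, Matrix.trace_mul_comm, ← Matrix.mul_assoc, ← Matrix.mul_assoc, Matrix.trace_mul_comm,
      ← Matrix.mul_assoc]
  have htot : ∑ y, ∑ x, (E x y * ρ * (E x y)ᴴ).trace.re = 1 := by
    have h1 : ∑ x, ∑ y, (E x y * ρ * (E x y)ᴴ).trace = 1 := by
      simp only [htr, ← Matrix.trace_sum, ← Matrix.sum_mul, ← Matrix.mul_sum]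
      rw [hE, Matrix.mul_one, Matrix.trace_mul_comm, ← hK, ht]
    have h2 := congrArg Complex.re h1
    rw [Finset.sum_comm]
    simpa using h2
  set Γ : Matrix ι ι ℂ := ∑ x ∈ Finset.univ.erase x0, ∑ y, (E x y)ᴴ * E x y with hΓ
  have hΓp : Γ.PosSemidef := posSemidef_sum _ fun x _ => posSemidef_sum _ fun y _ =>
    posSemidef_conjTranspose_mul_self _
  have hsum : Γ + ∑ y, (E x0 y)ᴴ * E x0 y = 1 := by
    rw [← hE]; exact Finset.sum_erase_add _ _ (Finset.mem_univ x0)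
  have hdec : Kᴴ * K = Kᴴ * Γ * K + ∑ y, Kᴴ * ((E x0 y)ᴴ * E x0 y) * K := by
    rw [← Matrix.sum_mul, ← Matrix.mul_sum, ← Matrix.add_mul, ← Matrix.mul_add, hsum,
      Matrix.mul_one]
  have hpsd : ∀ y, (Kᴴ * ((E x0 y)ᴴ * E x0 y) * K).PosSemidef := fun y =>
    (posSemidef_conjTranspose_mul_self _).conjTranspose_mul_mul_same K
  have hΓK : (Kᴴ * Γ * K).PosSemidef := hΓp.conjTranspose_mul_mul_same K
  have hS1 : SS ρ ≤ SS (Kᴴ * Γ * K) + ∑ y, SS (Kᴴ * ((E x0 y)ᴴ * E x0 y) * K) := by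
    rw [hK, SS_mul_comm, hdec]
    exact (SS_add_le hΓK (posSemidef_sum _ fun y _ => hpsd y)).trans
      (add_le_add_right (SS_sum_le _ hpsd) _)
  have htΓ : (Kᴴ * Γ * K).trace.re = 1 - ∑ y, (E x0 y * ρ * (E x0 y)ᴴ).trace.re := by
    have h1 := congrArg Matrix.trace hdec
    rw [Matrix.trace_mul_comm, ← hK, ht, Matrix.trace_add, Matrix.trace_sum] at h1
    simp only [← htr] at h1
    have h2 := congrArg Complex.re h1
    simp at h2
    linarith
  have hS2 : SS (Kᴴ * Γ * K) ≤ 1 + ε * Real.log (Fintype.card ι) := by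
    have h1 := SS_le_card hΓK
    have h2 := psd_trace_re hΓK
    have h3 := Real.negMulLog_le_one_sub_self h2
    have h4 := mul_le_mul_of_nonneg_right (show (Kᴴ * Γ * K).trace.re ≤ ε by linarith)
      (log_card_nonneg (Fintype.card ι))
    linarith
  have hS3 : ∀ y, SS (Kᴴ * ((E x0 y)ᴴ * E x0 y) * K) ≤
      Real.negMulLog (E x0 y * ρ * (E x0 y)ᴴ).trace.re +
        (E x0 y * ρ * (E x0 y)ᴴ).trace.re * Real.log (Fintype.card γ) := by
    intro y
    have : SS (Kᴴ * ((E x0 y)ᴴ * E x0 y) * K) = SS (E x0 y * ρ * (E x0 y)ᴴ) := by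
      rw [hK, ← Matrix.mul_assoc, Matrix.mul_assoc, SS_mul_comm]
      simp only [Matrix.mul_assoc]
    rw [this]
    exact SS_le_card (hρ.mul_mul_conjTranspose_same _)
  have hS4 : ∀ y, Real.negMulLog (E x0 y * ρ * (E x0 y)ᴴ).trace.re ≤
      Real.negMulLog (∑ x, (E x y * ρ * (E x y)ᴴ).trace.re) +
        (∑ x, (E x y * ρ * (E x y)ᴴ).trace.re) * Real.log 2 := by
    intro y
    have h1 : ∑ x, (E x y * ρ * (E x y)ᴴ).trace.re = (E x0 y * ρ * (E x0 y)ᴴ).trace.re +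
      ∑ x ∈ Finset.univ.erase x0, (E x y * ρ * (E x y)ᴴ).trace.re :=
      (Finset.add_sum_erase _ _ (Finset.mem_univ x0)).symm
    have h2 : ∑ x, (E x y * ρ * (E x y)ᴴ).trace.re ≤ 1 := by
      rw [← htot]
      exact Finset.single_le_sum (f := fun y => ∑ x, (E x y * ρ * (E x y)ᴴ).trace.re)
        (fun y _ => Finset.sum_nonneg fun x _ => hq0 x y) (Finset.mem_univ y)
    have h3 : 0 ≤ ∑ x ∈ Finset.univ.erase x0, (E x y * ρ * (E x y)ᴴ).trace.re :=
      Finset.sum_nonneg fun x _ => hq0 x y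
    have h4 := hq0 x0 y
    rw [h1]
    exact negMulLog_split h4 h3 (by linarith)
  have hp1 : ∑ y, (E x0 y * ρ * (E x0 y)ᴴ).trace.re ≤ 1 := by
    have := psd_trace_re hΓK
    linarith
  have hS5 := Finset.sum_le_sum fun y (_ : y ∈ Finset.univ) => hS3 y
  have hS6 := Finset.sum_le_sum fun y (_ : y ∈ Finset.univ) => hS4 y
  rw [Finset.sum_add_distrib, ← Finset.sum_mul] at hS5 hS6
  rw [htot] at hS6
  have hS7 := mul_le_mul_of_nonneg_right hp1 (log_card_nonneg (Fintype.card γ))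
  linarith

/-- Erasing the outcome with probability `1 - l`. -/
lemma holevo_erase {m : ℕ} (M : Fin m → Matrix ι ι ℂ) (h : ∀ y, (M y).PosSemidef)
    (ht : (∑ y, M y).trace = 1) (l : ℝ) (M' : Fin (m + 1) → Matrix ι ι ℂ)
    (h0 : M' 0 = ((1 - l : ℝ) : ℂ) • ∑ y, M y) (h1 : ∀ y, M' y.succ = (l : ℂ) • M y) :
    holevo M' = l * holevo M := by
  have hN : (∑ y, M y).PosSemidef := posSemidef_sum _ fun y _ => h y
  have hs : ∑ y, M' y = ∑ y, M y := by
    rw [Fin.sum_univ_succ, h0]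
    simp only [h1]
    rw [← Finset.smul_sum, ← add_smul]
    simp
  have htr : ∑ y, (M y).trace.re = 1 := by
    rw [Matrix.trace_sum] at ht
    have := congrArg Complex.re ht
    simpa using this
  unfold holevo
  rw [hs, Fin.sum_univ_succ, Fin.sum_univ_succ (fun y => SS (M' y)), h0]
  simp only [h1]
  rw [SS_smul hN, ht]
  simp only [SS_smul (h _), Matrix.trace_smul, smul_eq_mul, Complex.re_ofReal_mul, ht,
    Real.negMulLog_mul, Complex.one_re, mul_one]
  rw [Finset.sum_add_distrib, Finset.sum_add_distrib, ← Finset.sum_mul, ← Finset.mul_sum,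
    ← Finset.mul_sum, ← Finset.mul_sum, htr]
  simp
  ring

lemma tpow_mul {n : ℕ} (A : Matrix ι ι ℂ) (B : Matrix ι ι ℂ) :
    tpow A n * tpow B n = tpow (A * B) n := by
  ext x y
  rw [Matrix.mul_apply]
  simp only [tpow, Matrix.mul_apply]
  rw [Finset.prod_univ_sum, Fintype.piFinset_univ]
  simp only [Finset.prod_mul_distrib]

lemma tpow_diagonal {n : ℕ} (d : ι → ℂ) :
    tpow (diagonal d) n = diagonal (fun x => ∏ k, d (x k)) := by
  ext x y
  simp only [tpow, diagonal_apply]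
  by_cases h : x = y
  · subst h; simp
  · rw [if_neg h]
    obtain ⟨k, hk⟩ := Function.ne_iff.1 h
    exact Finset.prod_eq_zero (Finset.mem_univ k) (if_neg hk)

lemma tpow_one {n : ℕ} : tpow (1 : Matrix ι ι ℂ) n = 1 := by
  have := tpow_diagonal (n := n) (fun _ : ι => (1 : ℂ))
  simpa using this

lemma tpow_conjTranspose {n : ℕ} (A : Matrix ι ι ℂ) : (tpow A n)ᴴ = tpow Aᴴ n := by
  ext x y
  simp [tpow, Matrix.conjTranspose_apply]

lemma tpow_psd {n : ℕ} {A : Matrix ι ι ℂ} (h : A.PosSemidef) : (tpow A n).PosSemidef := by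
  obtain ⟨K, hK⟩ := exists_factor h
  rw [hK, ← tpow_mul, ← tpow_conjTranspose]
  exact posSemidef_self_mul_conjTranspose _

lemma tpow_trace {n : ℕ} {A : Matrix ι ι ℂ} (h : A.trace = 1) : (tpow A n).trace = 1 := by
  have : (tpow A n).trace = ∏ _k : Fin n, A.trace := by
    simp only [Matrix.trace, Matrix.diag, tpow]
    rw [Finset.prod_univ_sum, Fintype.piFinset_univ]
  rw [this, h]; simp

lemma sum_prod_pow (d : ι → ℝ) (hd : ∑ i, d i = 1) (n : ℕ) :
    ∑ x : Fin n → ι, ∏ k, d (x k) = 1 := by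
  have := (Finset.prod_univ_sum (fun _ : Fin n => (Finset.univ : Finset ι)) (fun _ i => d i))
  rw [Fintype.piFinset_univ] at this
  rw [← this, hd]; simp

lemma sum_negMulLog_pow (d : ι → ℝ) (hd : ∑ i, d i = 1) (n : ℕ) :
    ∑ x : Fin n → ι, Real.negMulLog (∏ k, d (x k)) = n * ∑ i, Real.negMulLog (d i) := by
  induction n with
  | zero => simp
  | succ n ih =>
    rw [← (Fin.consEquiv (fun _ : Fin (n + 1) => ι)).sum_comp, Fintype.sum_prod_type]
    have h2 := sum_prod_pow d hd n
    simp only [Fin.consEquiv, Equiv.coe_fn_mk, Fin.prod_univ_succ, Fin.cons_zero, Fin.cons_succ,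
      Real.negMulLog_mul, Finset.sum_add_distrib, ← Finset.sum_mul, ← Finset.mul_sum, h2, ih, hd]
    push_cast; ring

lemma SS_tpow {A : Matrix ι ι ℂ} (h : A.PosSemidef) (ht : A.trace = 1) (n : ℕ) :
    SS (tpow A n) = n * SS A := by
  obtain ⟨U, d, hU, hU', hd, hM, hS, hT⟩ := exists_diag h
  have h1 : ∑ i, d i = 1 := by
    rw [ht] at hT; exact_mod_cast hT.symm
  rw [hS]
  have : tpow A n = tpow U n * tpow (diagonal (fun i => (d i : ℂ))) n * (tpow U n)ᴴ := by
    rw [tpow_conjTranspose, tpow_mul, tpow_mul, ← hM]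
  rw [this, SS_conj _ (by rw [tpow_conjTranspose, tpow_mul, hU, tpow_one]), tpow_diagonal,
    SS_diagonal, ← sum_negMulLog_pow d h1 n]
  refine Finset.sum_congr rfl fun x _ => ?_
  rw [← Complex.ofReal_prod, Complex.ofReal_re]

end keylemmas

set_option linter.unusedSectionVars false
set_option linter.unusedSimpArgs false

section measure
variable {ι κ γ : Type*} [Fintype ι] [DecidableEq ι] [Fintype κ] [DecidableEq κ]
  [Fintype γ] [DecidableEq γ]

/-- Unnormalised post-measurement states. -/
def post (Λ : POVM ι κ) (τ : Matrix (ι × γ) (ι × γ) ℂ) (y : κ) : Matrix γ γ ℂ :=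
  fun b b' => ∑ a, ∑ a', (Λ.elem y) a a' * τ (a', b) (a, b')

lemma measureLeft_eq (Λ : POVM ι κ) (τ : Matrix (ι × γ) (ι × γ) ℂ) :
    measureLeft Λ τ = cq (post Λ τ) := rfl

lemma post_psd (Λ : POVM ι κ) {τ : Matrix (ι × γ) (ι × γ) ℂ} (h : τ.PosSemidef) (y : κ) :
    (post Λ τ y).PosSemidef := by
  obtain ⟨K, hK⟩ := exists_factor (Λ.pos y)
  let F : ι → Matrix γ (ι × γ) ℂ := fun c b p => if b = p.2 then star (K p.1 c) else 0
  have hF : ∀ c b p, F c b p = if b = p.2 then star (K p.1 c) else 0 := fun _ _ _ => rfl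
  have : post Λ τ y = ∑ c, F c * τ * (F c)ᴴ := by
    ext b b'
    rw [Matrix.sum_apply]
    have : ∀ c, (F c * τ * (F c)ᴴ) b b' =
        ∑ a, ∑ a', K a c * star (K a' c) * τ (a', b) (a, b') := by
      intro c
      rw [Matrix.mul_apply, Fintype.sum_prod_type]
      refine Finset.sum_congr rfl fun a _ => ?_
      simp only [Matrix.conjTranspose_apply, Matrix.mul_apply, hF, Fintype.sum_prod_type]
      simp only [ite_mul, zero_mul, Finset.sum_ite_eq, Finset.mem_univ, if_true]
      rw [Finset.sum_eq_single b' (fun x _ hx => by simp [Ne.symm hx]) (by simp)]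
      simp only [if_true, star_star, Finset.sum_mul]
      refine Finset.sum_congr rfl fun a' _ => ?_
      ring
    simp only [this]
    rw [Finset.sum_comm]
    unfold post
    refine Finset.sum_congr rfl fun a _ => ?_
    rw [Finset.sum_comm]
    refine Finset.sum_congr rfl fun a' _ => ?_
    rw [hK, Matrix.mul_apply, Finset.sum_mul]
    refine Finset.sum_congr rfl fun c _ => ?_
    rw [Matrix.conjTranspose_apply]
  rw [this]
  exact posSemidef_sum _ fun c _ => h.mul_mul_conjTranspose_same _

lemma post_sum (Λ : POVM ι κ) (τ : Matrix (ι × γ) (ι × γ) ℂ) :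
    ∑ y, post Λ τ y = ptraceLeft τ := by
  ext b b'
  rw [Matrix.sum_apply]
  unfold post ptraceLeft
  rw [Finset.sum_comm]
  refine Finset.sum_congr rfl fun a _ => ?_
  rw [Finset.sum_comm]
  simp only [← Finset.sum_mul]
  have : ∀ a', ∑ y, Λ.elem y a a' = (1 : Matrix ι ι ℂ) a a' := by
    intro a'; rw [← Λ.sum_eq, Matrix.sum_apply]
  simp [this, Matrix.one_apply]

lemma trace_ptraceLeft (τ : Matrix (ι × γ) (ι × γ) ℂ) : (ptraceLeft τ).trace = τ.trace := by
  simp only [Matrix.trace, Matrix.diag, ptraceLeft, Fintype.sum_prod_type]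
  exact Finset.sum_comm

lemma trace_ptraceRight (τ : Matrix (ι × γ) (ι × γ) ℂ) : (ptraceRight τ).trace = τ.trace := by
  simp only [Matrix.trace, Matrix.diag, ptraceRight, Fintype.sum_prod_type]

lemma post_trace (Λ : POVM ι κ) {τ : Matrix (ι × γ) (ι × γ) ℂ} (h : τ.trace = 1) :
    (∑ y, post Λ τ y).trace = 1 := by
  rw [post_sum, trace_ptraceLeft, h]

lemma ptraceLeft_psd {τ : Matrix (ι × γ) (ι × γ) ℂ} (h : τ.PosSemidef) :
    (ptraceLeft τ).PosSemidef := by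
  have : ptraceLeft τ = ∑ a, τ.submatrix (fun b => (a, b)) (fun b => (a, b)) := by
    ext b b'
    rw [Matrix.sum_apply]; rfl
  rw [this]
  exact posSemidef_sum _ fun a _ => h.submatrix _

lemma ptraceRight_psd {τ : Matrix (ι × γ) (ι × γ) ℂ} (h : τ.PosSemidef) :
    (ptraceRight τ).PosSemidef := by
  have : ptraceRight τ = ∑ b, τ.submatrix (fun a => (a, b)) (fun a => (a, b)) := by
    ext b b'
    rw [Matrix.sum_apply]; rfl
  rw [this]
  exact posSemidef_sum _ fun a _ => h.submatrix _

lemma sqrt_mul {M : Matrix ι ι ℂ} (h : M.PosSemidef) : h.sqrt * h.sqrtᴴ = M := by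
  have hs := h.1.spectral_theorem
  rw [Unitary.conjStarAlgAut_apply] at hs
  have hU : (star h.1.eigenvectorUnitary : Matrix ι ι ℂ) * h.1.eigenvectorUnitary.1 = 1 :=
    Unitary.coe_star_mul_self h.1.eigenvectorUnitary
  have hU2 : (star h.1.eigenvectorUnitary : Matrix ι ι ℂ) = (h.1.eigenvectorUnitary.1)ᴴ := rfl
  conv_rhs => rw [hs]
  unfold PosSemidef.sqrt
  rw [hU2] at hU
  rw [hU2, Matrix.conjTranspose_mul, Matrix.conjTranspose_mul, Matrix.conjTranspose_conjTranspose,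
    diagonal_conjTranspose]
  rw [Matrix.mul_assoc, ← Matrix.mul_assoc (h.1.eigenvectorUnitary.1)ᴴ, hU, Matrix.one_mul,
    Matrix.mul_assoc, ← Matrix.mul_assoc (diagonal _) (diagonal _), diagonal_mul_diagonal,
    ← Matrix.mul_assoc]
  congr 3
  ext i
  simp [← Complex.ofReal_mul, Real.mul_self_sqrt (h.eigenvalues_nonneg i)]

lemma purif_ptrace {M : Matrix ι ι ℂ} (h : M.PosSemidef) (p q : ι) :
    ∑ e, canonicalPurification M (p, e) (q, e) = M p q := by
  have h1 := congrFun (congrFun (sqrt_mul h) p) q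
  rw [Matrix.mul_apply] at h1
  rw [← h1, canonicalPurification, dif_pos h]
  rfl

lemma purif_psd {M : Matrix ι ι ℂ} (h : M.PosSemidef) : (canonicalPurification M).PosSemidef := by
  rw [canonicalPurification, dif_pos h]
  exact posSemidef_vecMulVec_self_star _

end measure

section single
variable {α β : Type*} [Fintype α] [DecidableEq α] [Fintype β] [DecidableEq β]

lemma purifyAssoc_psd {ρ : Matrix (α × β) (α × β) ℂ} (hρ : IsDensity ρ) :
    (purifyAssoc ρ).PosSemidef := by
  unfold purifyAssoc
  rw [Matrix.reindex_apply]
  exact (purif_psd hρ.1).submatrix _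

lemma purifyAssoc_trace {ρ : Matrix (α × β) (α × β) ℂ} (hρ : IsDensity ρ) :
    (purifyAssoc ρ).trace = 1 := by
  have h1 : (purifyAssoc ρ).trace = (canonicalPurification ρ).trace := by
    unfold purifyAssoc
    rw [Matrix.reindex_apply]
    simp only [Matrix.trace, Matrix.diag, Matrix.submatrix_apply]
    exact (Equiv.prodAssoc α β (α × β)).symm.sum_comp
      (fun x => canonicalPurification ρ x x)
  rw [h1, ← hρ.2]
  simp only [Matrix.trace, Matrix.diag]
  rw [Fintype.sum_prod_type]
  exact Finset.sum_congr rfl fun p _ => purif_ptrace hρ.1 p p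

lemma IYBE_eq {m : ℕ} {ρ : Matrix (α × β) (α × β) ℂ} (hρ : IsDensity ρ) (Λ : POVM α (Fin m)) :
    IYBE (sigmaOf ρ Λ) = holevo (post Λ (purifyAssoc ρ)) := by
  unfold IYBE sigmaOf
  rw [measureLeft_eq, mutualInfo_cq _ (post_psd Λ (purifyAssoc_psd hρ))]

lemma IYB_eq {m : ℕ} {ρ : Matrix (α × β) (α × β) ℂ} (hρ : IsDensity ρ) (Λ : POVM α (Fin m)) :
    IYB (sigmaOf ρ Λ) = holevo (post Λ ρ) := by
  unfold IYB sigmaOf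
  rw [← mutualInfo_cq _ (post_psd Λ hρ.1)]
  congr 1
  ext ⟨y, b⟩ ⟨y', b'⟩
  simp only [ptraceRight, Matrix.reindex_apply, Matrix.submatrix_apply, measureLeft, cq, post]
  by_cases hy : y = y'
  · subst hy
    simp only [Equiv.symm_symm, Equiv.prodAssoc_apply, if_true]
    rw [Finset.sum_comm]
    refine Finset.sum_congr rfl fun a _ => ?_
    rw [Finset.sum_comm]
    refine Finset.sum_congr rfl fun a' _ => ?_
    rw [← Finset.mul_sum, ← purif_ptrace hρ.1]
    rfl
  · simp [hy]

/-- Mixing a POVM with the trivial measurement. -/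
def erasePOVM {m : ℕ} (Λ : POVM α (Fin m)) (l : ℝ) (h0 : 0 ≤ l) (h1 : l ≤ 1) :
    POVM α (Fin (m + 1)) where
  elem := Fin.cons (((1 - l : ℝ) : ℂ) • 1) (fun y => (l : ℂ) • Λ.elem y)
  pos := by
    intro y
    refine Fin.cases ?_ (fun y => ?_) y
    · rw [Fin.cons_zero]
      exact PosSemidef.one.smul (by exact_mod_cast sub_nonneg.2 h1)
    · rw [Fin.cons_succ]
      exact (Λ.pos y).smul (by exact_mod_cast h0)
  sum_eq := by
    rw [Fin.sum_univ_succ]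
    simp only [Fin.cons_zero, Fin.cons_succ]
    rw [← Finset.smul_sum, Λ.sum_eq, ← add_smul]
    simp

lemma erase_holevo {γ : Type*} [Fintype γ] [DecidableEq γ] {m : ℕ} (Λ : POVM α (Fin m)) (l : ℝ)
    (h0 : 0 ≤ l) (h1 : l ≤ 1)
    {τ : Matrix (α × γ) (α × γ) ℂ} (h : τ.PosSemidef) (ht : τ.trace = 1) :
    holevo (post (erasePOVM Λ l h0 h1) τ) = l * holevo (post Λ τ) := by
  refine holevo_erase _ (post_psd Λ h) (post_trace Λ ht) l _ ?_ ?_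
  · rw [post_sum]
    ext b b'
    simp [post, erasePOVM, ptraceLeft, Matrix.one_apply, Finset.mul_sum]
  · intro y
    ext b b'
    simp only [post, erasePOVM, Fin.cons_succ, Matrix.smul_apply, smul_eq_mul, Finset.mul_sum,
      mul_assoc]

lemma holevo_le_P1 {m : ℕ} {ρ : Matrix (α × β) (α × β) ℂ} (hρ : IsDensity ρ)
    (Λ : POVM α (Fin m)) {R x : ℝ} (hR : 0 ≤ R) (hx : 0 < x) (hm : Real.log m ≤ R + x) :
    holevo (post Λ ρ) ≤ P1 ρ R + x := by
  have hpos : 0 < R + x := by linarith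
  set l := R / (R + x) with hl
  have h0 : 0 ≤ l := div_nonneg hR hpos.le
  have h1 : l ≤ 1 := by rw [hl, div_le_one hpos]; linarith
  have hb1 := holevo_le_log _ (post_psd Λ hρ.1) (post_trace Λ hρ.2)
  have hb2 := holevo_le_log _ (post_psd Λ (purifyAssoc_psd hρ)) (post_trace Λ (purifyAssoc_trace hρ))
  rw [Fintype.card_fin] at hb1 hb2
  have hlR : l * (R + x) = R := by rw [hl]; field_simp
  have hP : l * holevo (post Λ ρ) ≤ P1 ρ R := by
    unfold P1
    refine le_csSup ⟨Real.log (Fintype.card β), ?_⟩ ⟨m + 1, erasePOVM Λ l h0 h1, ?_, ?_⟩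
    · rintro v ⟨m', Λ', -, rfl⟩
      rw [IYB_eq hρ]
      exact holevo_le_log_dim _ (post_psd Λ' hρ.1) (post_trace Λ' hρ.2)
    · rw [IYBE_eq hρ, erase_holevo Λ l h0 h1 (purifyAssoc_psd hρ) (purifyAssoc_trace hρ)]
      calc _ ≤ l * (R + x) := mul_le_mul_of_nonneg_left (hb2.trans hm) h0
        _ = R := hlR
    · rw [IYB_eq hρ, erase_holevo Λ l h0 h1 hρ.1 hρ.2]
  have h2 := mul_le_mul_of_nonneg_left (hb1.trans hm) (sub_nonneg.2 h1)
  nlinarith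

end single

set_option linter.unusedSectionVars false
set_option linter.unusedSimpArgs false

section variants
variable {ι κ γ δ : Type*} [Fintype ι] [DecidableEq ι] [Fintype κ] [DecidableEq κ]
  [Fintype γ] [DecidableEq γ] [Fintype δ] [DecidableEq δ]

lemma key_alice {a : Type*} [Fintype a] [DecidableEq a] {ρ : Matrix ι ι ℂ} (hρ : ρ.PosSemidef)
    (ht : ρ.trace = 1) (U : Matrix ((a × κ) × γ) ι ℂ) (hU : Uᴴ * U = 1) (x0 : a) (ε : ℝ)
    (hp : 1 - ε ≤ ∑ y, ∑ g, ((U * ρ * Uᴴ) ((x0, y), g) ((x0, y), g)).re) :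
    SS ρ ≤ ∑ y, Real.negMulLog (∑ x, ∑ g, ((U * ρ * Uᴴ) ((x, y), g) ((x, y), g)).re)
      + (Real.log 2 + 1)
      + Real.log (Fintype.card γ) + ε * Real.log (Fintype.card ι) := by
  let E : a → κ → Matrix γ ι ℂ := fun x y => U.submatrix (fun g => ((x, y), g)) id
  have hE : ∑ x, ∑ y, (E x y)ᴴ * E x y = 1 := by
    rw [← hU]
    ext i j
    simp only [Matrix.sum_apply, Matrix.mul_apply, Fintype.sum_prod_type, E,
      Matrix.conjTranspose_apply, Matrix.submatrix_apply, id]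
  have htr : ∀ x y, (E x y * ρ * (E x y)ᴴ).trace.re =
      ∑ g, ((U * ρ * Uᴴ) ((x, y), g) ((x, y), g)).re := by
    intro x y
    rw [Matrix.trace, Complex.re_sum]
    rfl
  have := key_bound hρ ht E hE x0 ε (by simpa only [htr] using hp)
  simpa only [htr] using this

lemma key_bob {a : Type*} [Fintype a] [DecidableEq a] {ρ : Matrix ι ι ℂ} (hρ : ρ.PosSemidef)
    (ht : ρ.trace = 1) (U : Matrix (a × γ) ι ℂ) (hU : Uᴴ * U = 1) (x0 : a) (ε : ℝ)
    (hp : 1 - ε ≤ ∑ g, ((U * ρ * Uᴴ) (x0, g) (x0, g)).re) :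
    SS ρ ≤ (Real.log 2 + 1) + Real.log (Fintype.card γ) + ε * Real.log (Fintype.card ι) := by
  let E : a → Unit → Matrix γ ι ℂ := fun x _ => U.submatrix (fun g => (x, g)) id
  have hE : ∑ x, ∑ y, (E x y)ᴴ * E x y = 1 := by
    rw [← hU]
    ext i j
    simp only [Matrix.sum_apply, Matrix.mul_apply, Fintype.sum_prod_type, E,
      Matrix.conjTranspose_apply, Matrix.submatrix_apply, id, Finset.univ_unique,
      Finset.sum_singleton]
  have htr : ∀ x y, (E x y * ρ * (E x y)ᴴ).trace.re =
      ∑ g, ((U * ρ * Uᴴ) (x, g) (x, g)).re := by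
    intro x y
    rw [Matrix.trace, Complex.re_sum]
    rfl
  have htot : ∑ x, ∑ g, ((U * ρ * Uᴴ) (x, g) (x, g)).re = 1 := by
    have h1 : (U * ρ * Uᴴ).trace = 1 := by
      rw [Matrix.trace_mul_comm, ← Matrix.mul_assoc, hU, Matrix.one_mul, ht]
    have h2 := congrArg Complex.re h1
    rw [Matrix.trace, Complex.re_sum, Fintype.sum_prod_type] at h2
    simpa using h2
  have := key_bound hρ ht E hE x0 ε (by simpa [htr] using hp)
  simpa [htr, htot] using this

lemma ptraceRight_conj (A : Matrix κ ι ℂ) (Q : Matrix (ι × γ) (ι × γ) ℂ) :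
    ptraceRight ((A ⊗ₖ (1 : Matrix γ γ ℂ)) * Q * (A ⊗ₖ (1 : Matrix γ γ ℂ))ᴴ) =
      A * ptraceRight Q * Aᴴ := by
  have key : ∀ p q, ((A ⊗ₖ (1 : Matrix γ γ ℂ)) * Q * (A ⊗ₖ (1 : Matrix γ γ ℂ))ᴴ) p q =
      ∑ j, (∑ i, A p.1 i * Q (i, p.2) (j, q.2)) * star (A q.1 j) := by
    intro p q
    rw [Matrix.mul_apply, Fintype.sum_prod_type]
    refine Finset.sum_congr rfl fun j _ => ?_
    rw [Finset.sum_eq_single q.2 (fun x _ hx => by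
      simp [Matrix.conjTranspose_apply, Matrix.kroneckerMap_apply, Matrix.one_apply, Ne.symm hx])
      (by simp)]
    rw [Matrix.mul_apply, Fintype.sum_prod_type]
    congr 1
    · refine Finset.sum_congr rfl fun i _ => ?_
      rw [Finset.sum_eq_single p.2 (fun x _ hx => by
        simp [Matrix.kroneckerMap_apply, Matrix.one_apply, Ne.symm hx]) (by simp)]
      simp [Matrix.kroneckerMap_apply]
    · simp [Matrix.conjTranspose_apply, Matrix.kroneckerMap_apply]
  ext a a'
  simp only [ptraceRight, key]
  rw [Finset.sum_comm, Matrix.mul_apply]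
  refine Finset.sum_congr rfl fun j _ => ?_
  rw [← Finset.sum_mul, Matrix.conjTranspose_apply]
  congr 1
  rw [Finset.sum_comm, Matrix.mul_apply]
  refine Finset.sum_congr rfl fun i _ => ?_
  rw [← Finset.mul_sum]
  rfl

lemma ptraceLeft_conj (A : Matrix κ ι ℂ) (hA : Aᴴ * A = 1) (Q : Matrix (ι × γ) (ι × γ) ℂ) :
    ptraceLeft ((A ⊗ₖ (1 : Matrix γ γ ℂ)) * Q * (A ⊗ₖ (1 : Matrix γ γ ℂ))ᴴ) = ptraceLeft Q := by
  have key : ∀ p q, ((A ⊗ₖ (1 : Matrix γ γ ℂ)) * Q * (A ⊗ₖ (1 : Matrix γ γ ℂ))ᴴ) p q =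
      ∑ j, ∑ i, (star (A q.1 j) * A p.1 i) * Q (i, p.2) (j, q.2) := by
    intro p q
    rw [Matrix.mul_apply, Fintype.sum_prod_type]
    refine Finset.sum_congr rfl fun j _ => ?_
    rw [Finset.sum_eq_single q.2 (fun x _ hx => by
      simp [Matrix.conjTranspose_apply, Matrix.kroneckerMap_apply, Matrix.one_apply, Ne.symm hx])
      (by simp)]
    rw [Matrix.mul_apply, Fintype.sum_prod_type, Finset.sum_mul]
    refine Finset.sum_congr rfl fun i _ => ?_
    rw [Finset.sum_eq_single p.2 (fun x _ hx => by
      simp [Matrix.kroneckerMap_apply, Matrix.one_apply, Ne.symm hx]) (by simp)]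
    simp [Matrix.kroneckerMap_apply, Matrix.conjTranspose_apply]
    ring
  ext b b'
  simp only [ptraceLeft, key]
  rw [Finset.sum_comm]
  refine Finset.sum_congr rfl fun j _ => ?_
  rw [Finset.sum_comm]
  simp only [← Finset.sum_mul]
  have : ∀ i, ∑ x, star (A x j) * A x i = (1 : Matrix ι ι ℂ) j i := by
    intro i
    rw [← hA, Matrix.mul_apply]
    rfl
  simp only [this]
  simp [Matrix.one_apply]

lemma dephaseFst_psd {M : Matrix (κ × γ) (κ × γ) ℂ} (h : M.PosSemidef) :
    (dephaseFst M).PosSemidef := by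
  let D : κ → Matrix (κ × γ) (κ × γ) ℂ := fun y => diagonal (fun p => if p.1 = y then 1 else 0)
  have : dephaseFst M = ∑ y, D y * M * (D y)ᴴ := by
    ext p q
    rw [Matrix.sum_apply]
    simp only [D, diagonal_conjTranspose, Matrix.mul_diagonal, Matrix.diagonal_mul]
    simp only [dephaseFst]
    by_cases hpq : p.1 = q.1
    · simp [hpq]
    · simp [hpq, Ne.symm hpq]
  rw [this]
  exact posSemidef_sum _ fun y _ => h.mul_mul_conjTranspose_same _

end variants

section tp
variable {α β : Type*} [Fintype α] [DecidableEq α] [Fintype β] [DecidableEq β]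

lemma tpowAB_density {ρ : Matrix (α × β) (α × β) ℂ} (hρ : IsDensity ρ) (n : ℕ) :
    IsDensity (tpowAB ρ n) := by
  constructor
  · unfold tpowAB
    rw [Matrix.reindex_apply]
    exact (tpow_psd hρ.1).submatrix _
  · rw [← tpow_trace (n := n) hρ.2]
    unfold tpowAB
    rw [Matrix.reindex_apply]
    simp only [Matrix.trace, Matrix.diag, Matrix.submatrix_apply]
    exact (Equiv.arrowProdEquivProdArrow (Fin n) (fun _ => α) (fun _ => β)).symm.sum_comp
      (fun x => tpow ρ n x x)

lemma tpowAB_apply (ρ : Matrix (α × β) (α × β) ℂ) (n : ℕ) (a a' : Fin n → α) (b b' : Fin n → β) :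
    tpowAB ρ n (a, b) (a', b') = ∏ k, ρ (a k, b k) (a' k, b' k) := rfl

lemma ptraceRight_tpowAB (ρ : Matrix (α × β) (α × β) ℂ) (n : ℕ) :
    ptraceRight (tpowAB ρ n) = tpow (ptraceRight ρ) n := by
  ext a a'
  simp only [ptraceRight, tpowAB_apply, tpow]
  rw [Finset.prod_univ_sum, Fintype.piFinset_univ]

lemma ptraceLeft_tpowAB (ρ : Matrix (α × β) (α × β) ℂ) (n : ℕ) :
    ptraceLeft (tpowAB ρ n) = tpow (ptraceLeft ρ) n := by
  ext a a'
  simp only [ptraceLeft, tpowAB_apply, tpow]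
  rw [Finset.prod_univ_sum, Fintype.piFinset_univ]

end tp

set_option linter.unusedSectionVars false
set_option linter.unusedSimpArgs false
section conj
variable {ι κ γ : Type*} [Fintype ι] [DecidableEq ι] [Fintype κ] [DecidableEq κ]
  [Fintype γ] [DecidableEq γ]

lemma conj_apply (A : Matrix κ ι ℂ) (Q : Matrix (ι × γ) (ι × γ) ℂ) (p q : κ × γ) :
    ((A ⊗ₖ (1 : Matrix γ γ ℂ)) * Q * (A ⊗ₖ (1 : Matrix γ γ ℂ))ᴴ) p q =
      ∑ j, ∑ i, (star (A q.1 j) * A p.1 i) * Q (i, p.2) (j, q.2) := by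
  rw [Matrix.mul_apply, Fintype.sum_prod_type]
  refine Finset.sum_congr rfl fun j _ => ?_
  rw [Finset.sum_eq_single q.2 (fun x _ hx => by
    simp [Matrix.conjTranspose_apply, Matrix.kroneckerMap_apply, Matrix.one_apply, Ne.symm hx])
    (by simp)]
  rw [Matrix.mul_apply, Fintype.sum_prod_type, Finset.sum_mul]
  refine Finset.sum_congr rfl fun i _ => ?_
  rw [Finset.sum_eq_single p.2 (fun x _ hx => by
    simp [Matrix.kroneckerMap_apply, Matrix.one_apply, Ne.symm hx]) (by simp)]
  simp [Matrix.kroneckerMap_apply, Matrix.conjTranspose_apply]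
  ring

lemma card_eq_of_unitary (U : Matrix κ ι ℂ) (h1 : Uᴴ * U = 1) (h2 : U * Uᴴ = 1) :
    Fintype.card κ = Fintype.card ι := by
  have := Matrix.trace_mul_comm U Uᴴ
  rw [h1, h2, Matrix.trace_one, Matrix.trace_one] at this
  exact_mod_cast this

end conj

section prot
variable {α β : Type*} [Fintype α] [DecidableEq α] [Fintype β] [DecidableEq β] {n : ℕ}

/-- Embedding adding the catalyst in the zero state. -/
def embC (Pr : Protocol α β n) : Matrix ((Fin n → α) × Fin Pr.dC) (Fin n → α) ℂ :=
  fun p a => if p.1 = a ∧ p.2 = ⟨0, Pr.dC_pos⟩ then 1 else 0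

lemma embC_iso (Pr : Protocol α β n) : (embC Pr)ᴴ * embC Pr = 1 := by
  ext a a'
  rw [Matrix.mul_apply, Fintype.sum_prod_type]
  simp only [Matrix.conjTranspose_apply, embC, Matrix.one_apply, ite_and]
  by_cases h : a = a'
  · subst h; simp [apply_ite]
  · rw [if_neg h]
    refine Finset.sum_eq_zero fun x _ => Finset.sum_eq_zero fun c _ => ?_
    by_cases h1 : x = a
    · have : x ≠ a' := by rw [h1]; exact h
      simp [this]
    · simp [h1]

/-- Alice's isometry. -/
def isoV (Pr : Protocol α β n) : Matrix ((Fin Pr.dAp × Fin Pr.dY) × Fin Pr.dAg) (Fin n → α) ℂ :=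
  Pr.UA * embC Pr

lemma isoV_iso (Pr : Protocol α β n) : (isoV Pr)ᴴ * isoV Pr = 1 := by
  unfold isoV
  rw [Matrix.conjTranspose_mul, Matrix.mul_assoc, ← Matrix.mul_assoc (Pr.UA)ᴴ,
    Pr.UA_unitary.1, Matrix.one_mul, embC_iso]

lemma inputState_eq (ρ : Matrix (α × β) (α × β) ℂ) (Pr : Protocol α β n) :
    inputState ρ Pr = (embC Pr ⊗ₖ (1 : Matrix (Fin n → β) (Fin n → β) ℂ)) * tpowAB ρ n *
      (embC Pr ⊗ₖ (1 : Matrix (Fin n → β) (Fin n → β) ℂ))ᴴ := by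
  ext ⟨⟨a, c⟩, b⟩ ⟨⟨a', c'⟩, b'⟩
  rw [conj_apply]
  have hL : inputState ρ Pr ((a, c), b) ((a', c'), b') =
      tpowAB ρ n (a, b) (a', b') * pureZero Pr.dC c c' := rfl
  rw [hL]
  by_cases h1 : c = ⟨0, Pr.dC_pos⟩
  · by_cases h2 : c' = ⟨0, Pr.dC_pos⟩
    · simp [embC, pureZero, h1, h2]
    · have h3 : c'.val ≠ 0 := fun h => h2 (Fin.ext h)
      simp [embC, pureZero, h2, h3]
  · have h3 : c.val ≠ 0 := fun h => h1 (Fin.ext h)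
    simp [embC, pureZero, h1, h3]

lemma stateAfterUA_eq (ρ : Matrix (α × β) (α × β) ℂ) (Pr : Protocol α β n) :
    stateAfterUA ρ Pr = (isoV Pr ⊗ₖ (1 : Matrix (Fin n → β) (Fin n → β) ℂ)) * tpowAB ρ n *
      (isoV Pr ⊗ₖ (1 : Matrix (Fin n → β) (Fin n → β) ℂ))ᴴ := by
  have : isoV Pr ⊗ₖ (1 : Matrix (Fin n → β) (Fin n → β) ℂ) =
      (Pr.UA ⊗ₖ (1 : Matrix (Fin n → β) (Fin n → β) ℂ)) *
        (embC Pr ⊗ₖ (1 : Matrix (Fin n → β) (Fin n → β) ℂ)) := by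
    rw [← Matrix.mul_kronecker_mul, Matrix.one_mul]; rfl
  rw [this, stateAfterUA, inputState_eq, Matrix.conjTranspose_mul]
  simp only [Matrix.mul_assoc]

/-- The POVM of Alice. -/
def povmV (Pr : Protocol α β n) : POVM (Fin n → α) (Fin Pr.dY) where
  elem y := ((isoV Pr).submatrix (fun p : Fin Pr.dAp × Fin Pr.dAg => ((p.1, y), p.2)) id)ᴴ *
    ((isoV Pr).submatrix (fun p : Fin Pr.dAp × Fin Pr.dAg => ((p.1, y), p.2)) id)
  pos y := Matrix.posSemidef_conjTranspose_mul_self _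
  sum_eq := by
    rw [← isoV_iso Pr]
    ext i j
    simp only [Matrix.sum_apply, Matrix.mul_apply, Fintype.sum_prod_type,
      Matrix.conjTranspose_apply, Matrix.submatrix_apply, id]
    exact Finset.sum_comm

lemma post_povmV (ρ : Matrix (α × β) (α × β) ℂ) (Pr : Protocol α β n) (y : Fin Pr.dY)
    (b b' : Fin n → β) : post (povmV Pr) (tpowAB ρ n) y b b' =
      ∑ x, ∑ g, stateAfterUA ρ Pr (((x, y), g), b) (((x, y), g), b') := by
  simp only [stateAfterUA_eq, conj_apply]
  simp only [post, povmV, Matrix.mul_apply, Fintype.sum_prod_type,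
      Matrix.conjTranspose_apply, Matrix.submatrix_apply, id, Finset.sum_mul]
  have h1 : ∀ (F : (Fin n → α) → (Fin n → α) → Fin Pr.dAp → Fin Pr.dAg → ℂ),
      ∑ a, ∑ a', ∑ x, ∑ g, F a a' x g = ∑ x, ∑ g, ∑ a, ∑ a', F a a' x g := by
    intro F
    calc _ = ∑ a, ∑ x, ∑ a', ∑ g, F a a' x g :=
        Finset.sum_congr rfl fun a _ => Finset.sum_comm
      _ = ∑ x, ∑ a, ∑ a', ∑ g, F a a' x g := Finset.sum_comm
      _ = ∑ x, ∑ a, ∑ g, ∑ a', F a a' x g :=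
        Finset.sum_congr rfl fun a _ => Finset.sum_congr rfl fun a _ => Finset.sum_comm
      _ = _ := Finset.sum_congr rfl fun a _ => Finset.sum_comm
  exact h1 _

lemma stateAfterUA_psd {ρ : Matrix (α × β) (α × β) ℂ} (hρ : IsDensity ρ) (Pr : Protocol α β n) :
    (stateAfterUA ρ Pr).PosSemidef := by
  rw [stateAfterUA_eq]
  exact (tpowAB_density hρ n).1.mul_mul_conjTranspose_same _

/-- State handed to Bob's unitary. -/
def stQ (ρ : Matrix (α × β) (α × β) ℂ) (Pr : Protocol α β n) :=
  Matrix.reindex (pullBY (Fin Pr.dAp) (Fin Pr.dY) (Fin Pr.dAg) (Fin n → β))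
      (pullBY (Fin Pr.dAp) (Fin Pr.dY) (Fin Pr.dAg) (Fin n → β)) (stateAfterDephasing ρ Pr)

lemma stQ_apply (ρ : Matrix (α × β) (α × β) ℂ) (Pr : Protocol α β n) (b b') (y y' : Fin Pr.dY)
    (x x' : Fin Pr.dAp) (g g' : Fin Pr.dAg) :
    stQ ρ Pr ((b, y), (x, g)) ((b', y'), (x', g')) =
      if y = y' then stateAfterUA ρ Pr (((x, y), g), b) (((x', y'), g'), b') else 0 := rfl

lemma stQ_psd {ρ : Matrix (α × β) (α × β) ℂ} (hρ : IsDensity ρ) (Pr : Protocol α β n) :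
    (stQ ρ Pr).PosSemidef := by
  unfold stQ stateAfterDephasing
  simp only [Matrix.reindex_apply]
  refine Matrix.PosSemidef.submatrix (Matrix.PosSemidef.submatrix (dephaseFst_psd ?_) _) _
  exact (stateAfterUA_psd hρ Pr).submatrix _

lemma ptraceRight_stQ (ρ : Matrix (α × β) (α × β) ℂ) (Pr : Protocol α β n) :
    ptraceRight (stQ ρ Pr) = Matrix.reindex (Equiv.prodComm _ _) (Equiv.prodComm _ _)
      (cq (post (povmV Pr) (tpowAB ρ n))) := by
  ext ⟨b, y⟩ ⟨b', y'⟩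
  simp only [ptraceRight, Fintype.sum_prod_type, stQ_apply]
  simp only [Matrix.reindex_apply, Matrix.submatrix_apply, Equiv.prodComm_symm,
    Equiv.prodComm_apply, Prod.swap_prod_mk, cq]
  by_cases h : y = y'
  · subst h
    simp only [if_true, post_povmV]
  · simp [h]

lemma stateAfterUB_eq (ρ : Matrix (α × β) (α × β) ℂ) (Pr : Protocol α β n) :
    stateAfterUB ρ Pr =
    (Pr.UB ⊗ₖ (1 : Matrix (Fin Pr.dAp × Fin Pr.dAg) (Fin Pr.dAp × Fin Pr.dAg) ℂ)) * stQ ρ Pr *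
    (Pr.UB ⊗ₖ (1 : Matrix (Fin Pr.dAp × Fin Pr.dAg) (Fin Pr.dAp × Fin Pr.dAg) ℂ))ᴴ := rfl

lemma stateAfterUB_psd {ρ : Matrix (α × β) (α × β) ℂ} (hρ : IsDensity ρ) (Pr : Protocol α β n) :
    (stateAfterUB ρ Pr).PosSemidef := by
  rw [stateAfterUB_eq]
  exact (stQ_psd hρ Pr).mul_mul_conjTranspose_same _

lemma dims (Pr : Protocol α β n) :
    Real.log Pr.dAp + Real.log Pr.dY + Real.log Pr.dAg =
      n * Real.log (Fintype.card α) + Real.log Pr.dC ∧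
    Real.log Pr.dBp + Real.log Pr.dBg = n * Real.log (Fintype.card β) + Real.log Pr.dY := by
  have hA := card_eq_of_unitary Pr.UA Pr.UA_unitary.1 Pr.UA_unitary.2
  have hB := card_eq_of_unitary Pr.UB Pr.UB_unitary.1 Pr.UB_unitary.2
  simp only [Fintype.card_prod, Fintype.card_fin, Fintype.card_fun] at hA hB
  have p1 : (Pr.dC : ℝ) ≠ 0 := by exact_mod_cast Pr.dC_pos.ne'
  have p2 : (Pr.dAp : ℝ) ≠ 0 := by exact_mod_cast Pr.dAp_pos.ne'
  have p3 : (Pr.dY : ℝ) ≠ 0 := by exact_mod_cast Pr.dY_pos.ne'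
  have p4 : (Pr.dAg : ℝ) ≠ 0 := by exact_mod_cast Pr.dAg_pos.ne'
  have p5 : (Pr.dBp : ℝ) ≠ 0 := by exact_mod_cast Pr.dBp_pos.ne'
  have p6 : (Pr.dBg : ℝ) ≠ 0 := by exact_mod_cast Pr.dBg_pos.ne'
  have hA' : (Pr.dAp : ℝ) * Pr.dY * Pr.dAg = (Fintype.card α : ℝ) ^ n * Pr.dC := by
    exact_mod_cast hA
  have hB' : (Pr.dBp : ℝ) * Pr.dBg = (Fintype.card β : ℝ) ^ n * Pr.dY := by
    exact_mod_cast hB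
  constructor
  · rw [← Real.log_mul p2 p3, ← Real.log_mul (mul_ne_zero p2 p3) p4, hA', Real.log_mul _ p1,
      Real.log_pow]
    intro h
    rw [h, zero_mul] at hA'
    exact mul_ne_zero (mul_ne_zero p2 p3) p4 hA'
  · rw [← Real.log_mul p5 p6, hB', Real.log_mul _ p3, Real.log_pow]
    intro h
    rw [h, zero_mul] at hB'
    exact mul_ne_zero p5 p6 hB'

end prot

set_option linter.unusedSectionVars false
section bound
variable {α β : Type*} [Fintype α] [DecidableEq α] [Fintype β] [DecidableEq β] {n : ℕ}

lemma out_bound {ρ : Matrix (α × β) (α × β) ℂ} (Pr : Protocol α β n) :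
    1 - protocolError ρ Pr ≤ ∑ g : Fin Pr.dAg, ∑ h : Fin Pr.dBg,
      (stateAfterUB ρ Pr ((⟨0, Pr.dBp_pos⟩, h), (⟨0, Pr.dAp_pos⟩, g))
        ((⟨0, Pr.dBp_pos⟩, h), (⟨0, Pr.dAp_pos⟩, g))).re := by
  have h := diag_le_traceNorm (outputReduced ρ Pr - pureZero Pr.dAp ⊗ₖ pureZero Pr.dBp)
    (⟨0, Pr.dAp_pos⟩, ⟨0, Pr.dBp_pos⟩)
  have h1 : (pureZero Pr.dAp ⊗ₖ pureZero Pr.dBp) (⟨0, Pr.dAp_pos⟩, ⟨0, Pr.dBp_pos⟩)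
      (⟨0, Pr.dAp_pos⟩, ⟨0, Pr.dBp_pos⟩) = 1 := by
    simp [Matrix.kroneckerMap_apply, pureZero]
  have h2 : outputReduced ρ Pr (⟨0, Pr.dAp_pos⟩, ⟨0, Pr.dBp_pos⟩)
      (⟨0, Pr.dAp_pos⟩, ⟨0, Pr.dBp_pos⟩) = ∑ g : Fin Pr.dAg, ∑ h : Fin Pr.dBg,
      stateAfterUB ρ Pr ((⟨0, Pr.dBp_pos⟩, h), (⟨0, Pr.dAp_pos⟩, g))
        ((⟨0, Pr.dBp_pos⟩, h), (⟨0, Pr.dAp_pos⟩, g)) := by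
    unfold outputReduced ptraceRight
    rw [Fintype.sum_prod_type]
    rfl
  rw [Matrix.sub_apply, h1, h2, Complex.sub_re, Complex.re_sum] at h
  simp only [Complex.re_sum, Complex.one_re] at h
  unfold protocolError
  linarith

lemma diag_re_nonneg {ι : Type*} [Fintype ι] {M : Matrix ι ι ℂ} (h : M.PosSemidef) (i : ι) :
    0 ≤ (M i i).re := by
  classical
  exact (Complex.le_def.1 (h.diag_nonneg (i := i))).1

lemma bob_p0 {ρ : Matrix (α × β) (α × β) ℂ} (hρ : IsDensity ρ) (Pr : Protocol α β n) :
    1 - protocolError ρ Pr ≤ ∑ h : Fin Pr.dBg,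
      ((Pr.UB * ptraceRight (stQ ρ Pr) * Pr.UBᴴ) (⟨0, Pr.dBp_pos⟩, h) (⟨0, Pr.dBp_pos⟩, h)).re := by
  refine (out_bound Pr).trans ?_
  rw [← ptraceRight_conj, ← stateAfterUB_eq, Finset.sum_comm]
  refine Finset.sum_le_sum fun h _ => ?_
  unfold ptraceRight
  rw [Complex.re_sum, Fintype.sum_prod_type]
  exact Finset.single_le_sum (f := fun x => ∑ g, (stateAfterUB ρ Pr ((⟨0, Pr.dBp_pos⟩, h), (x, g))
        ((⟨0, Pr.dBp_pos⟩, h), (x, g))).re)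
    (fun x _ => Finset.sum_nonneg fun g _ => diag_re_nonneg (stateAfterUB_psd hρ Pr) _)
    (Finset.mem_univ (⟨0, Pr.dAp_pos⟩ : Fin Pr.dAp))

lemma alice_diag (ρ : Matrix (α × β) (α × β) ℂ) (Pr : Protocol α β n) (i) :
    (isoV Pr * ptraceRight (tpowAB ρ n) * (isoV Pr)ᴴ) i i =
      ∑ b, stateAfterUA ρ Pr (i, b) (i, b) := by
  rw [← ptraceRight_conj, ← stateAfterUA_eq]
  rfl

lemma alice_p0 {ρ : Matrix (α × β) (α × β) ℂ} (hρ : IsDensity ρ) (Pr : Protocol α β n) :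
    1 - protocolError ρ Pr ≤ ∑ y, ∑ g,
      ((isoV Pr * ptraceRight (tpowAB ρ n) * (isoV Pr)ᴴ) ((⟨0, Pr.dAp_pos⟩, y), g)
        ((⟨0, Pr.dAp_pos⟩, y), g)).re := by
  refine (out_bound Pr).trans ?_
  rw [Finset.sum_comm (s := (Finset.univ : Finset (Fin Pr.dY)))]
  refine Finset.sum_le_sum fun g _ => ?_
  have h1 : ∑ y, (isoV Pr * ptraceRight (tpowAB ρ n) * (isoV Pr)ᴴ) ((⟨0, Pr.dAp_pos⟩, y), g)
        ((⟨0, Pr.dAp_pos⟩, y), g) =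
      ptraceLeft (stateAfterUB ρ Pr) (⟨0, Pr.dAp_pos⟩, g) (⟨0, Pr.dAp_pos⟩, g) := by
    rw [stateAfterUB_eq, ptraceLeft_conj _ Pr.UB_unitary.1]
    simp only [alice_diag, ptraceLeft, Fintype.sum_prod_type, stQ_apply, if_true]
    exact Finset.sum_comm
  have h2 := congrArg Complex.re h1
  rw [Complex.re_sum] at h2
  rw [h2]
  unfold ptraceLeft
  rw [Complex.re_sum, Fintype.sum_prod_type]
  exact Finset.single_le_sum (f := fun x => ∑ h, (stateAfterUB ρ Pr ((x, h), (⟨0, Pr.dAp_pos⟩, g))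
        ((x, h), (⟨0, Pr.dAp_pos⟩, g))).re)
    (fun x _ => Finset.sum_nonneg fun g _ => diag_re_nonneg (stateAfterUB_psd hρ Pr) _)
    (Finset.mem_univ (⟨0, Pr.dBp_pos⟩ : Fin Pr.dBp))

lemma protocol_bound {ρ : Matrix (α × β) (α × β) ℂ} (hρ : IsDensity ρ) (Pr : Protocol α β n) :
    Real.log Pr.dAp + Real.log Pr.dBp - Real.log Pr.dC ≤
      n * kappa (ptraceRight ρ) + n * kappa (ptraceLeft ρ)
      + holevo (post (povmV Pr) (tpowAB ρ n)) + 2 * (Real.log 2 + 1)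
      + protocolError ρ Pr * (n * Real.log (Fintype.card α) + n * Real.log (Fintype.card β)
        + Real.log Pr.dY) := by
  have hτ := tpowAB_density hρ n
  have hPA := ptraceRight_psd hρ.1
  have hPB := ptraceLeft_psd hρ.1
  have hkA : entropy (ptraceRight ρ) = SS (ptraceRight ρ) := entropy_eq_SS hPA.1
  have hkB : entropy (ptraceLeft ρ) = SS (ptraceLeft ρ) := entropy_eq_SS hPB.1
  have hSA : SS (ptraceRight (tpowAB ρ n)) = n * SS (ptraceRight ρ) := by
    rw [ptraceRight_tpowAB, SS_tpow hPA (by rw [trace_ptraceRight]; exact hρ.2)]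
  have hSB : SS (ptraceLeft (tpowAB ρ n)) = n * SS (ptraceLeft ρ) := by
    rw [ptraceLeft_tpowAB, SS_tpow hPB (by rw [trace_ptraceLeft]; exact hρ.2)]
  have hA := key_alice (ptraceRight_psd hτ.1) (by rw [trace_ptraceRight]; exact hτ.2)
    (isoV Pr) (isoV_iso Pr) ⟨0, Pr.dAp_pos⟩ _ (alice_p0 hρ Pr)
  have htQ : (ptraceRight (stQ ρ Pr)).trace = 1 := by
    have h := post_trace (povmV Pr) hτ.2
    rw [← h, ptraceRight_stQ]
    simp only [Matrix.trace, Matrix.diag, Matrix.reindex_apply, Matrix.submatrix_apply,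
      Fintype.sum_prod_type, Equiv.prodComm_symm, Equiv.prodComm_apply, Prod.swap_prod_mk, cq,
      if_true, Matrix.sum_apply]
  have hB := key_bob (ptraceRight_psd (stQ_psd hρ Pr)) htQ Pr.UB Pr.UB_unitary.1
    ⟨0, Pr.dBp_pos⟩ _ (bob_p0 hρ Pr)
  rw [ptraceRight_stQ, SS_reindex, SS_cq _ (post_psd _ hτ.1)] at hB
  have hq : ∀ y, (post (povmV Pr) (tpowAB ρ n) y).trace.re =
      ∑ x, ∑ g, ((isoV Pr * ptraceRight (tpowAB ρ n) * (isoV Pr)ᴴ) ((x, y), g) ((x, y), g)).re := by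
    intro y
    simp only [alice_diag, Matrix.trace, Matrix.diag, post_povmV, Complex.re_sum]
    rw [Finset.sum_comm]
    exact Finset.sum_congr rfl fun x _ => Finset.sum_comm
  simp only [← hq] at hA
  rw [hSA] at hA
  obtain ⟨d1, d2⟩ := dims Pr
  unfold holevo kappa
  rw [post_sum, hSB, hkA, hkB]
  simp only [Fintype.card_fun, Fintype.card_fin, Fintype.card_prod, Nat.cast_pow, Nat.cast_mul]
    at hA hB
  rw [Real.log_pow] at hA
  have hcard : protocolError ρ Pr * Real.log ((Fintype.card β : ℝ) ^ n * Pr.dY) =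
      protocolError ρ Pr * (n * Real.log (Fintype.card β) + Real.log Pr.dY) := by
    rw [← d2, ← Real.log_mul]
    · congr 2
      have := card_eq_of_unitary Pr.UB Pr.UB_unitary.1 Pr.UB_unitary.2
      simp only [Fintype.card_prod, Fintype.card_fin, Fintype.card_fun] at this
      exact_mod_cast this.symm
    · exact_mod_cast Pr.dBp_pos.ne'
    · exact_mod_cast Pr.dBg_pos.ne'
  rw [hcard] at hB
  linarith

end bound

/-- **Converse part of the main theorem.** If the rate pair `(P,R)` is achievable, then
`P ≤ κ*_→(ρ^{AB},R) = κ(ρ^A) + κ(ρ^B) + P_→(ρ^{AB},R)`, where `P_→` is the limit of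
`(1/n) P^{(1)}_→((ρ^{AB})^{⊗n}, nR)`. -/
theorem converse {α β : Type*} [Fintype α] [DecidableEq α] [Fintype β] [DecidableEq β]
    (ρ : Matrix (α × β) (α × β) ℂ) (hρ : IsDensity ρ) (R : ℝ) (hR : 0 ≤ R) (P Pinf : ℝ)
    (hlim : Filter.Tendsto (fun n : ℕ => P1 (tpowAB ρ n) (n * R) / n)
      Filter.atTop (nhds Pinf))
    (hach : Achievable ρ P R) :
    P ≤ kappa (ptraceRight ρ) + kappa (ptraceLeft ρ) + Pinf := by
  set K := kappa (ptraceRight ρ) + kappa (ptraceLeft ρ) with hK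
  set L := Real.log (Fintype.card α) + Real.log (Fintype.card β) with hL
  have hLa : 0 ≤ Real.log (Fintype.card α) := Real.log_natCast_nonneg _
  have hLb : 0 ≤ Real.log (Fintype.card β) := Real.log_natCast_nonneg _
  have key : ∀ δ > (0 : ℝ), P ≤ K + Pinf + δ * (4 + L + R + δ) := by
    intro δ hδ
    obtain ⟨N, hN⟩ := hach δ hδ δ hδ
    have e1 : ∀ᶠ n : ℕ in atTop, P1 (tpowAB ρ n) (n * R) / n < Pinf + δ :=
      hlim.eventually (gt_mem_nhds (by linarith))
    have e2 : ∀ᶠ n : ℕ in atTop, 2 * (Real.log 2 + 1) / (n : ℝ) < δ :=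
      (tendsto_const_div_atTop_nhds_zero_nat _).eventually (gt_mem_nhds hδ)
    obtain ⟨n, h1, h2, h3, h4⟩ := (e1.and (e2.and ((eventually_ge_atTop N).and
      (eventually_ge_atTop 1)))).exists
    obtain ⟨Pr, hc, hp, he⟩ := hN n h3
    have hn : (0 : ℝ) < n := by exact_mod_cast h4
    have hb := protocol_bound hρ Pr
    unfold commRate at hc
    rw [div_le_iff₀ hn] at hc
    have hh := holevo_le_P1 (tpowAB_density hρ n) (povmV Pr) (R := n * R) (x := n * δ)
      (by positivity) (by positivity) (by linarith)
    unfold purityRate at hp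
    rw [le_div_iff₀ hn, Real.log_mul (by exact_mod_cast Pr.dAp_pos.ne')
      (by exact_mod_cast Pr.dBp_pos.ne')] at hp
    rw [div_lt_iff₀ hn] at h1 h2
    have hY : 0 ≤ Real.log Pr.dY := Real.log_natCast_nonneg _
    have h5 : protocolError ρ Pr * (n * Real.log (Fintype.card α) +
        n * Real.log (Fintype.card β) + Real.log Pr.dY) ≤
        δ * (n * Real.log (Fintype.card α) + n * Real.log (Fintype.card β) + (R + δ) * n) := by
      refine mul_le_mul he (by linarith) (by positivity) hδ.le
    have h6 : P * n ≤ (K + Pinf + δ * (4 + L + R + δ)) * n := by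
      rw [hK, hL]
      have : 0 < δ * n := by positivity
      nlinarith
    exact le_of_mul_le_mul_right h6 hn
  have ht : Tendsto (fun δ : ℝ => K + Pinf + δ * (4 + L + R + δ)) (nhdsWithin 0 (Set.Ioi 0))
      (nhds (K + Pinf)) := by
    have hcont : Continuous (fun δ : ℝ => K + Pinf + δ * (4 + L + R + δ)) := by fun_prop
    have := hcont.tendsto 0
    simp only [zero_mul, add_zero] at this
    exact this.mono_left nhdsWithin_le_nhds
  exact ge_of_tendsto ht (eventually_nhdsWithin_of_forall fun δ hδ => key δ hδ)

end LPD
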